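/- First tetrahedral symmetry: for positive reals a, c with b := 1/2 − a − c > 0 and all real x, y, one has g_{a,c}(x, y) = conj( g_{a,b}(−x, y − x − 1/2) ) · e^{πix/2}, where conj denotes complex conjugation and g_{a,b} is the function g with parameter pair (a, b). -/

import Mathlib

open Real MeasureTheory

noncomputable section

/-- `c_𝖻 = i(𝖻 + 𝖻⁻¹)/2`. -/
def cB (bb : ℝ) : ℂ := Complex.I * (bb + bb⁻¹) / 2

/-- The integrand in the definition of Faddeev's quantum dilogarithm. -/
def phiKer (bb : ℝ) (z w : ℂ) : ℂ :=
  Complex.exp (-2 * Complex.I * z * w) /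
    (4 * Complex.sinh (w * bb) * Complex.sinh (w / bb) * w)

/-- Faddeev's quantum dilogarithm on the strip `|Im z| < Im c_𝖻`, defined by the
contour integral over `ℝ + iε` with `ε = π·min(𝖻,𝖻⁻¹)/2`. -/
def PhiS (bb : ℝ) (z : ℂ) : ℂ :=
  Complex.exp (∫ t : ℝ, phiKer bb z (t + Complex.I * (π * min bb bb⁻¹ / 2)))

/-- The factor appearing in the functional equation:
`Φ_𝖻(z) = Efac 𝖻 z · Φ_𝖻(z + i𝖻)`. -/
def Efac (bb : ℝ) (z : ℂ) : ℂ := 1 + Complex.exp (2 * π * bb * (z + Complex.I * bb / 2))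

/-- Number of upward shifts by `i𝖻` needed to bring `z` into the strip. -/
def nUp (bb : ℝ) (z : ℂ) : ℕ := ⌊(-((bb + bb⁻¹) / 2) - z.im) / bb⌋₊ + 1

/-- Number of downward shifts by `i𝖻` needed to bring `z` into the strip. -/
def nDn (bb : ℝ) (z : ℂ) : ℕ := ⌊(z.im - (bb + bb⁻¹) / 2) / bb⌋₊ + 1

/-- Faddeev's quantum dilogarithm `Φ_𝖻`, extended from the strip `|Im z| < Im c_𝖻`
to all of `ℂ` as a meromorphic function by the functional equation
`Φ_𝖻(z - i𝖻/2) = (1 + e^{2π𝖻z}) Φ_𝖻(z + i𝖻/2)`. -/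
def Phi (bb : ℝ) (z : ℂ) : ℂ :=
  if z.im ≤ -((bb + bb⁻¹) / 2) then
    (∏ k ∈ Finset.range (nUp bb z), Efac bb (z + Complex.I * k * bb)) *
      PhiS bb (z + Complex.I * (nUp bb z) * bb)
  else if (bb + bb⁻¹) / 2 ≤ z.im then
    PhiS bb (z - Complex.I * (nDn bb z) * bb) /
      ∏ k ∈ Finset.range (nDn bb z), Efac bb (z - Complex.I * (k + 1) * bb)
  else PhiS bb z

/-- `ψ_{a,c}(t) = Φ_𝖻(t - 2c_𝖻(a+c))⁻¹ e^{-4πi c_𝖻 a (t - c_𝖻(a+c))} e^{-πi c_𝖻²(4(a-c)+1)/6}`. -/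
def psiF (bb a c : ℝ) (t : ℂ) : ℂ :=
  (Phi bb (t - 2 * cB bb * (a + c)))⁻¹ *
    Complex.exp (-4 * π * Complex.I * cB bb * a * (t - cB bb * (a + c))) *
    Complex.exp (-π * Complex.I * (cB bb) ^ 2 * (4 * (a - c) + 1) / 6)

/-- `ψ̄_{a,c}(t) = Φ_𝖻(t + 2c_𝖻(a+c)) e^{-4πi c_𝖻 a (t + c_𝖻(a+c))} e^{πi c_𝖻²(4(a-c)+1)/6}`. -/
def psiBar (bb a c : ℝ) (t : ℂ) : ℂ :=
  Phi bb (t + 2 * cB bb * (a + c)) *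
    Complex.exp (-4 * π * Complex.I * cB bb * a * (t + cB bb * (a + c))) *
    Complex.exp (π * Complex.I * (cB bb) ^ 2 * (4 * (a - c) + 1) / 6)

/-- `ψ̃_{a,c}(s) = ∫_ℝ ψ_{a,c}(t) e^{-2πi s t} dt`. -/
def psiT (bb a c : ℝ) (s : ℝ) : ℂ :=
  ∫ t : ℝ, psiF bb a c t * Complex.exp (-2 * π * Complex.I * s * t)

/-- `ψ̃′_{a,c}(s) = e^{-πi s²} ψ̃_{a,c}(s)`. -/
def psiT' (bb a c : ℝ) (s : ℝ) : ℂ :=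
  Complex.exp (-π * Complex.I * s ^ 2) * psiT bb a c s

/-- `g_{a,c}(s,t) = Σ_{m∈ℤ} ψ̃′_{a,c}(s+m) e^{iπ t (s+2m)}`. -/
def gW (bb a c : ℝ) (s t : ℝ) : ℂ :=
  ∑' m : ℤ, psiT' bb a c (s + m) * Complex.exp (Complex.I * π * t * (s + 2 * m))

open Filter Topology in
/-- An entire function of sublinear growth is constant. -/
theorem Differentiable.apply_eq_apply_of_isLittleO {g : ℂ → ℂ} (hg : Differentiable ℂ g)
    (ho : g =o[cocompact ℂ] (fun z => z)) (z w : ℂ) : g z = g w := by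
  have hd : Differentiable ℂ (dslope g w) := by
    rw [← differentiableOn_univ]
    exact (Complex.differentiableOn_dslope univ_mem).2 hg.differentiableOn
  have hid : (fun z : ℂ => z) =O[cocompact ℂ] fun z => z - w := by
    have h1 : Tendsto (fun z : ℂ => ‖z - w‖) (cocompact ℂ) atTop := by
      have h2 := tendsto_norm_cocompact_atTop (E := ℂ)
      refine tendsto_atTop_mono (f := fun z : ℂ => ‖z‖ - ‖w‖) (fun z => norm_sub_norm_le z w) ?_
      exact tendsto_atTop_add_const_right _ _ h2
    refine Asymptotics.IsBigO.of_bound (1 + ‖w‖) ?_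
    filter_upwards [h1.eventually_ge_atTop 1] with z hz
    have := norm_add_le (z - w) w
    rw [sub_add_cancel] at this
    nlinarith [norm_nonneg w]
  have hconst : (fun _ : ℂ => g w) =o[cocompact ℂ] fun z : ℂ => z := by
    rw [Asymptotics.isLittleO_const_left]
    exact Or.inr tendsto_norm_cocompact_atTop
  have ht : Tendsto (dslope g w) (cocompact ℂ) (𝓝 0) := by
    have h3 := ((ho.sub hconst).trans_isBigO hid).tendsto_div_nhds_zero
    refine h3.congr' ?_
    filter_upwards [(isCompact_singleton (x := w)).compl_mem_cocompact] with z hz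
    rw [dslope_of_ne _ hz, slope_def_field]
  have h0 := hd.apply_eq_of_tendsto_cocompact z ht
  rcases eq_or_ne z w with rfl | hzw
  · rfl
  · rw [dslope_of_ne _ hzw, slope_def_field, div_eq_zero_iff] at h0
    rcases h0 with h | h
    · exact sub_eq_zero.1 h
    · exact absurd (sub_eq_zero.1 h) hzw

open Filter Topology in
/-- An entire function of period `h` whose growth in the imaginary direction is slower than
that of `exp (2 * π * |im z| / h)` is constant. -/
theorem Function.Periodic.apply_eq_apply_of_growth {f : ℂ → ℂ} {h C κ : ℝ} (hh : 0 < h)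
    (hκ : κ < 2 * π / h) (hf : Differentiable ℂ f) (hp : Function.Periodic f h)
    (hb : ∀ z, ‖f z‖ ≤ C * Real.exp (κ * |z.im|)) (z w : ℂ) : f z = f w := by
  wlog hκ0 : 0 ≤ κ generalizing κ
  · refine this (κ := 0) (by positivity) (fun z => (hb z).trans ?_) le_rfl
    have hC : 0 ≤ C := by simpa using (norm_nonneg _).trans (hb 0)
    gcongr
    push Not at hκ0
    nlinarith
  have hC : 0 ≤ C := by simpa using (norm_nonneg _).trans (hb 0)
  set θ := κ * h / (2 * π) with hθ
  have hθ1 : θ < 1 := by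
    rw [lt_div_iff₀ hh] at hκ
    rw [hθ, div_lt_one (by positivity)]; exact hκ
  set g := Function.Periodic.cuspFunction h f with hg
  have hbq : ∀ q : ℂ, q ≠ 0 → ‖g q‖ ≤ C * Real.exp (θ * |Real.log ‖q‖|) := by
    intro q hq
    rw [hg, Function.Periodic.cuspFunction_eq_of_nonzero _ _ hq]
    refine (hb _).trans_eq ?_
    rw [Function.Periodic.im_invQParam, abs_mul, abs_div, abs_neg, abs_of_pos hh,
      abs_of_pos (by positivity : (0:ℝ) < 2 * π), hθ]
    ring_nf
  have hd0 : ∀ q : ℂ, q ≠ 0 → DifferentiableAt ℂ g q := by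
    intro q hq
    have := Function.Periodic.differentiableAt_cuspFunction hh.ne' hp (hf (invQParam h q))
    rwa [Function.Periodic.qParam_right_inv hh.ne' hq] at this
  have hgd : Differentiable ℂ g := by
    rw [← differentiableOn_univ]
    have hgup : g = Function.update g 0 (limUnder (𝓝[≠] 0) g) := by
      rw [hg, ← Function.Periodic.cuspFunction_zero_eq_limUnder_nhds_ne, Function.update_eq_self]
    rw [hgup]
    refine Complex.differentiableOn_update_limUnder_of_isLittleO univ_mem
      (fun q hq => (hd0 q hq.2).differentiableWithinAt) ?_
    have e1 : (fun q : ℂ => Real.exp (-Real.log ‖q‖ * θ)) =o[𝓝[≠] 0] fun q : ℂ => (q - 0)⁻¹ := by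
      rw [← Asymptotics.isLittleO_norm_right]
      have hlog : Tendsto (fun q : ℂ => -Real.log ‖q‖) (𝓝[≠] 0) atTop :=
        tendsto_neg_atBot_atTop.comp (Real.tendsto_log_nhdsGT_zero.comp tendsto_norm_nhdsNE_zero)
      have : (fun x : ℝ => Real.exp (x * θ)) =o[atTop] fun x => Real.exp x := by
        rw [Real.isLittleO_exp_comp_exp_comp]
        have : (fun x : ℝ => x - x * θ) = fun x => x * (1 - θ) := by ext; ring
        rw [this]
        exact tendsto_id.atTop_mul_const (by linarith)
      refine (this.comp_tendsto hlog).congr' (by rfl) ?_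
      filter_upwards [self_mem_nhdsWithin] with q hq
      have hq' : 0 < ‖q‖ := norm_pos_iff.2 hq
      simp [Real.exp_neg, Real.exp_log hq']
    refine Asymptotics.IsLittleO.sub ?_ ?_
    · refine Asymptotics.IsBigO.trans_isLittleO (Asymptotics.IsBigO.of_bound C ?_) e1
      filter_upwards [self_mem_nhdsWithin, nhdsWithin_le_nhds (Metric.ball_mem_nhds (0:ℂ) one_pos)]
        with q hq hq1
      have hq2 : ‖q‖ < 1 := by simpa using hq1
      have := hbq q hq
      rw [abs_of_nonpos (Real.log_nonpos (norm_nonneg _) hq2.le)] at this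
      rw [Real.norm_of_nonneg (Real.exp_nonneg _), mul_comm _ θ]
      exact this
    · rw [Asymptotics.isLittleO_const_left]
      right
      have : Tendsto (fun q : ℂ => ‖q‖⁻¹) (𝓝[≠] 0) atTop :=
        tendsto_inv_nhdsGT_zero.comp tendsto_norm_nhdsNE_zero
      refine this.congr fun q => by simp
  have hgo : g =o[cocompact ℂ] fun q => q := by
    have e1 : (fun q : ℂ => Real.exp (Real.log ‖q‖ * θ)) =o[cocompact ℂ] fun q : ℂ => q := by
      rw [← Asymptotics.isLittleO_norm_right]
      have hlog : Tendsto (fun q : ℂ => Real.log ‖q‖) (cocompact ℂ) atTop :=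
        Real.tendsto_log_atTop.comp tendsto_norm_cocompact_atTop
      have : (fun x : ℝ => Real.exp (x * θ)) =o[atTop] fun x => Real.exp x := by
        rw [Real.isLittleO_exp_comp_exp_comp]
        have : (fun x : ℝ => x - x * θ) = fun x => x * (1 - θ) := by ext; ring
        rw [this]
        exact tendsto_id.atTop_mul_const (by linarith)
      refine (this.comp_tendsto hlog).congr' (by rfl) ?_
      filter_upwards [(isCompact_singleton (x := (0:ℂ))).compl_mem_cocompact] with q hq
      have hq' : 0 < ‖q‖ := norm_pos_iff.2 hq
      simp [Real.exp_log hq']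
    refine Asymptotics.IsBigO.trans_isLittleO (Asymptotics.IsBigO.of_bound C ?_) e1
    filter_upwards [tendsto_norm_cocompact_atTop.eventually_ge_atTop 1] with q hq1
    have hq : q ≠ 0 := by rintro rfl; norm_num at hq1
    have := hbq q hq
    rw [abs_of_nonneg (Real.log_nonneg hq1)] at this
    rw [Real.norm_of_nonneg (Real.exp_nonneg _), mul_comm _ θ]
    exact this
  rw [← Function.Periodic.eq_cuspFunction hh.ne' hp z,
    ← Function.Periodic.eq_cuspFunction hh.ne' hp w]
  exact hgd.apply_eq_apply_of_isLittleO hgo _ _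

open Filter Topology in
/-- A holomorphic function on a horizontal strip of width larger than `h` which is `I * h`-periodic
there and has growth slower than that of `exp (2 * π * |re p| / h)` is constant. -/
theorem eq_of_strip_periodic {R : ℂ → ℂ} {α β y₀ h C κ : ℝ} (hh : 0 < h) (hα : α < y₀)
    (hβ : y₀ + h < β) (hκ : κ < 2 * π / h)
    (hR : ∀ p : ℂ, α < p.im → p.im < β → DifferentiableAt ℂ R p)
    (hper : ∀ p : ℂ, α < p.im → p.im + h < β → R (p + Complex.I * h) = R p)
    (hb : ∀ p : ℂ, y₀ ≤ p.im → p.im ≤ y₀ + h → ‖R p‖ ≤ C * Real.exp (κ * |p.re|))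
    {p q : ℂ} (hp : α < p.im) (hp' : p.im < β) (hq : α < q.im) (hq' : q.im < β) :
    R p = R q := by
  have hnat : ∀ (n : ℕ) (p : ℂ), α < p.im → p.im + h * n < β → R (p + Complex.I * h * n) = R p := by
    intro n
    induction n with
    | zero => intro p _ _; simp
    | succ n ih =>
      intro p h1 h2
      push_cast at h2 ⊢
      have h3 : (p + Complex.I * h * n).im = p.im + h * n := by simp
      rw [show p + Complex.I * h * ((n : ℂ) + 1) = (p + Complex.I * h * n) + Complex.I * h by ring,
        hper _ (by rw [h3]; nlinarith [n.cast_nonneg (α := ℝ)]) (by rw [h3]; linarith),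
        ih p h1 (by linarith)]
  have hinteg : ∀ (n : ℤ) (p : ℂ), α < p.im → p.im < β → α < p.im + h * n → p.im + h * n < β →
      R (p + Complex.I * h * n) = R p := by
    intro n p h1 h2 h3 h4
    obtain ⟨m, rfl | rfl⟩ := n.eq_nat_or_neg
    · simpa using hnat m p h1 (by simpa using h4)
    · have := hnat m (p + Complex.I * h * ((-m : ℤ) : ℂ)) (by simpa using h3) (by simpa using h2)
      rw [← this]
      congr 1
      push_cast
      ring
  set N : ℂ → ℤ := fun p => ⌊(p.im - y₀) / h⌋ with hN
  set F : ℂ → ℂ := fun p => R (p - Complex.I * h * N p) with hF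
  have him : ∀ (p : ℂ) (n : ℤ), (p - Complex.I * h * n).im = p.im - h * n := by
    intro p n; simp
  have hNl : ∀ p, y₀ ≤ (p - Complex.I * h * N p).im := by
    intro p
    have := Int.floor_le ((p.im - y₀) / h)
    rw [le_div_iff₀ hh] at this
    rw [him]; simp only [hN]; linarith
  have hNu : ∀ p, (p - Complex.I * h * N p).im < y₀ + h := by
    intro p
    have := Int.lt_floor_add_one ((p.im - y₀) / h)
    rw [div_lt_iff₀ hh] at this
    rw [him]; simp only [hN]; linarith
  have hFeq : ∀ (q : ℂ) (n : ℤ), α < (q - Complex.I * h * n).im → (q - Complex.I * h * n).im < β →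
      F q = R (q - Complex.I * h * n) := by
    intro q n h1 h2
    have e : q - Complex.I * h * N q = (q - Complex.I * h * n) + Complex.I * h * ((n - N q : ℤ)) := by
      push_cast; ring
    have hl := hNl q
    have hu := hNu q
    simp only [hF]
    rw [him] at h1 h2 hl hu
    rw [e, hinteg]
    · rwa [him]
    · rwa [him]
    · rw [him]; push_cast; linarith
    · rw [him]; push_cast; linarith
  have hFR : ∀ p : ℂ, α < p.im → p.im < β → F p = R p := by
    intro p h1 h2
    simpa using hFeq p 0 (by simpa using h1) (by simpa using h2)
  have hFd : Differentiable ℂ F := by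
    intro p
    have hl := hNl p
    have hu := hNu p
    have hd : DifferentiableAt ℂ (fun q => R (q - Complex.I * h * N p)) p :=
      (hR _ (by linarith) (by linarith)).comp p (by fun_prop)
    refine hd.congr_of_eventuallyEq ?_
    have hc : Continuous fun q : ℂ => (q - Complex.I * h * N p).im := by fun_prop
    filter_upwards [hc.continuousAt.eventually_const_lt (by linarith : α < _),
      hc.continuousAt.eventually_lt_const (by linarith : _ < β)] with q h1 h2
    exact hFeq q _ h1 h2
  have hFper : Function.Periodic (fun z => F (Complex.I * z)) h := by
    intro z
    have e : Complex.I * (z + h) - Complex.I * h * ((N (Complex.I * z) + 1 : ℤ) : ℂ)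
        = Complex.I * z - Complex.I * h * N (Complex.I * z) := by push_cast; ring
    have hl := hNl (Complex.I * z)
    have hu := hNu (Complex.I * z)
    have := hFeq (Complex.I * (z + h)) (N (Complex.I * z) + 1) (by rw [e]; linarith)
      (by rw [e]; linarith)
    rw [e] at this
    exact this
  have key := Function.Periodic.apply_eq_apply_of_growth (C := C) hh hκ
    (hFd.comp (differentiable_id.const_mul Complex.I)) hFper
    (fun z => by
      refine (hb _ (hNl _) (hNu _).le).trans_eq ?_
      simp)
  have := key (-Complex.I * p) (-Complex.I * q)
  simp only [Function.comp, ← mul_assoc] at this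
  simp only [mul_neg, Complex.I_mul_I, neg_neg, one_mul] at this
  rwa [hFR p hp hp', hFR q hq hq'] at this

theorem integrable_exp_neg_mul_abs {δ : ℝ} (hδ : 0 < δ) :
    Integrable fun x : ℝ => Real.exp (-δ * |x|) := by
  rw [← integrableOn_univ, ← Set.Iic_union_Ioi (a := (0 : ℝ)), integrableOn_union]
  constructor
  · refine (integrableOn_exp_mul_Iic hδ 0).congr_fun (fun x hx => ?_) measurableSet_Iic
    simp only [Set.mem_Iic] at hx
    rw [abs_of_nonpos hx]; ring_nf
  · refine (integrableOn_exp_mul_Ioi (neg_lt_zero.2 hδ) 0).congr_fun (fun x hx => ?_)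
      measurableSet_Ioi
    simp only [Set.mem_Ioi] at hx
    rw [abs_of_pos hx]

theorem integral_exp_neg_mul_abs {δ : ℝ} (hδ : 0 < δ) :
    ∫ x : ℝ, Real.exp (-δ * |x|) = 2 / δ := by
  have := integral_comp_abs (f := fun x => Real.exp (-δ * x))
  rw [this, integral_exp_mul_Ioi (neg_lt_zero.2 hδ)]
  simp
  field_simp

theorem norm_mul_exp_le_of_two_sided {v A B δ C x r : ℝ} (h0 : 0 ≤ v) (hA : v ≤ C * Real.exp (-A * x))
    (hB : v ≤ C * Real.exp (-B * x)) (h1 : A + δ ≤ r) (h2 : r ≤ B - δ) :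
    v * Real.exp (r * x) ≤ C * Real.exp (-δ * |x|) := by
  have hC : 0 ≤ C := nonneg_of_mul_nonneg_left (h0.trans hA) (Real.exp_pos _)
  rcases le_total 0 x with hx | hx
  · calc v * Real.exp (r * x) ≤ C * Real.exp (-B * x) * Real.exp (r * x) := by gcongr
      _ = C * Real.exp (-B * x + r * x) := by rw [mul_assoc, ← Real.exp_add]
      _ ≤ _ := by
        rw [abs_of_nonneg hx]
        gcongr
        nlinarith
  · calc v * Real.exp (r * x) ≤ C * Real.exp (-A * x) * Real.exp (r * x) := by gcongr
      _ = C * Real.exp (-A * x + r * x) := by rw [mul_assoc, ← Real.exp_add]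
      _ ≤ _ := by
        rw [abs_of_nonpos hx]
        gcongr
        nlinarith

section Laplace

variable {F : ℝ → ℂ} {A B C : ℝ}

theorem norm_laplace_kernel_le (hA : ∀ x, ‖F x‖ ≤ C * Real.exp (-A * x))
    (hB : ∀ x, ‖F x‖ ≤ C * Real.exp (-B * x)) {δ : ℝ} {z : ℂ} (h1 : A + δ ≤ z.re)
    (h2 : z.re ≤ B - δ) (x : ℝ) :
    ‖F x * Complex.exp (z * x)‖ ≤ C * Real.exp (-δ * |x|) := by
  rw [norm_mul, Complex.norm_exp, Complex.re_mul_ofReal]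
  exact norm_mul_exp_le_of_two_sided (norm_nonneg _) (hA x) (hB x) h1 h2

theorem integrable_laplace (hF : Continuous F) (hA : ∀ x, ‖F x‖ ≤ C * Real.exp (-A * x))
    (hB : ∀ x, ‖F x‖ ≤ C * Real.exp (-B * x)) {z : ℂ} (h1 : A < z.re) (h2 : z.re < B) :
    Integrable fun x : ℝ => F x * Complex.exp (z * x) := by
  obtain ⟨δ, hδ, hδ'⟩ := exists_between (lt_min (sub_pos.2 h1) (sub_pos.2 h2))
  rw [lt_min_iff] at hδ'
  refine ((integrable_exp_neg_mul_abs hδ).const_mul C).mono' (by fun_prop) (.of_forall fun x => ?_)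
  exact norm_laplace_kernel_le hA hB (by linarith) (by linarith) x

theorem norm_laplace_le (hA : ∀ x, ‖F x‖ ≤ C * Real.exp (-A * x))
    (hB : ∀ x, ‖F x‖ ≤ C * Real.exp (-B * x)) {δ : ℝ} (hδ : 0 < δ) {z : ℂ} (h1 : A + δ ≤ z.re)
    (h2 : z.re ≤ B - δ) :
    ‖∫ x : ℝ, F x * Complex.exp (z * x)‖ ≤ C * (2 / δ) := by
  rw [← integral_exp_neg_mul_abs hδ, ← integral_const_mul]
  exact norm_integral_le_of_norm_le ((integrable_exp_neg_mul_abs hδ).const_mul C)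
    (.of_forall (norm_laplace_kernel_le hA hB h1 h2))

/-- The two-sided Laplace transform may be differentiated under the integral sign. -/
theorem hasDerivAt_laplace (hF : Continuous F) (hA : ∀ x, ‖F x‖ ≤ C * Real.exp (-A * x))
    (hB : ∀ x, ‖F x‖ ≤ C * Real.exp (-B * x)) {z : ℂ} (h1 : A < z.re) (h2 : z.re < B) :
    Integrable (fun x : ℝ => x * (F x * Complex.exp (z * x))) ∧
    HasDerivAt (fun z : ℂ => ∫ x : ℝ, F x * Complex.exp (z * x))
      (∫ x : ℝ, x * (F x * Complex.exp (z * x))) z := by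
  obtain ⟨δ, hδ, hδ'⟩ := exists_between (lt_min (sub_pos.2 h1) (sub_pos.2 h2))
  rw [lt_min_iff] at hδ'
  have hC : 0 ≤ C := by simpa using (norm_nonneg _).trans (hA 0)
  obtain ⟨hl, hu⟩ := hδ'
  have hnhds : {w : ℂ | A + δ < w.re ∧ w.re < B - δ} ∈ nhds z := by
    refine IsOpen.mem_nhds ?_ ⟨by linarith, by linarith⟩
    exact (isOpen_lt continuous_const Complex.continuous_re).inter
      (isOpen_lt Complex.continuous_re continuous_const)
  refine hasDerivAt_integral_of_dominated_loc_of_deriv_le (μ := volume)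
    (bound := fun x => 2 / δ * C * Real.exp (-(δ / 2) * |x|)) hnhds
    (.of_forall fun w => by fun_prop) (integrable_laplace hF hA hB h1 h2)
    (F' := fun w x => x * (F x * Complex.exp (w * x))) (by fun_prop) (.of_forall fun x w hw => ?_)
    ((integrable_exp_neg_mul_abs (half_pos hδ)).const_mul _) (.of_forall fun x w hw => ?_)
  · have h3 := norm_laplace_kernel_le hA hB hw.1.le hw.2.le x
    rw [norm_mul, Complex.norm_real, Real.norm_eq_abs]
    have h4 : δ / 2 * |x| ≤ Real.exp (δ / 2 * |x|) := by
      linarith [Real.add_one_le_exp (δ / 2 * |x|)]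
    calc |x| * ‖F x * Complex.exp (w * x)‖ ≤ |x| * (C * Real.exp (-δ * |x|)) := by gcongr
      _ = 2 / δ * C * (δ / 2 * |x|) * Real.exp (-δ * |x|) := by field_simp
      _ ≤ 2 / δ * C * Real.exp (δ / 2 * |x|) * Real.exp (-δ * |x|) := by gcongr
      _ = 2 / δ * C * Real.exp (-(δ / 2) * |x|) := by
        rw [mul_assoc (2 / δ * C), ← Real.exp_add]
        congr 2
        ring
  · have : HasDerivAt (fun w : ℂ => Complex.exp (w * x)) (Complex.exp (w * x) * (1 * x)) w :=
      ((hasDerivAt_id w).mul_const _).cexp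
    refine (this.const_mul (F x)).congr_deriv ?_
    ring

end Laplace

open Filter Topology in
/-- Shifting a horizontal contour of integration. -/
theorem integral_horizontal_line_eq {f : ℂ → ℂ} {y₁ y₂ C δ : ℝ} (hδ : 0 < δ) (hy : y₁ ≤ y₂)
    (hf : ∀ z : ℂ, y₁ ≤ z.im → z.im ≤ y₂ → DifferentiableAt ℂ f z)
    (hb : ∀ x y : ℝ, y₁ ≤ y → y ≤ y₂ → ‖f (x + y * Complex.I)‖ ≤ C * Real.exp (-δ * |x|)) :
    ∫ x : ℝ, f (x + y₁ * Complex.I) = ∫ x : ℝ, f (x + y₂ * Complex.I) := by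
  have hinteg : ∀ y : ℝ, y₁ ≤ y → y ≤ y₂ → Integrable fun x : ℝ => f (x + y * Complex.I) := by
    intro y h1 h2
    refine ((integrable_exp_neg_mul_abs hδ).const_mul C).mono' ?_ (.of_forall fun x => hb x y h1 h2)
    refine (continuous_iff_continuousAt.2 fun x => ?_).aestronglyMeasurable
    exact ContinuousAt.comp (f := fun x : ℝ => (x + y * Complex.I : ℂ))
      (hf _ (by simpa using h1) (by simpa using h2)).continuousAt
      (by fun_prop)
  have t1 := intervalIntegral_tendsto_integral (hinteg y₁ le_rfl hy) tendsto_neg_atTop_atBot tendsto_id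
  have t2 := intervalIntegral_tendsto_integral (hinteg y₂ hy le_rfl) tendsto_neg_atTop_atBot tendsto_id
  have hE : Tendsto (fun T : ℝ => C * Real.exp (-δ * |T|) * |y₂ - y₁|) atTop (𝓝 0) := by
    have : Tendsto (fun T : ℝ => Real.exp (-δ * |T|)) atTop (𝓝 0) := by
      refine Real.tendsto_exp_atBot.comp ?_
      exact tendsto_abs_atTop_atTop.const_mul_atTop_of_neg (neg_lt_zero.2 hδ)
    simpa using (this.const_mul C).mul_const (|y₂ - y₁|)
  have side : ∀ s : ℝ, |s| = 1 →
      Tendsto (fun T : ℝ => ∫ y : ℝ in y₁..y₂, f ((s * T : ℝ) + y * Complex.I)) atTop (𝓝 0) := by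
    intro s hs
    refine squeeze_zero_norm (fun T => ?_) hE
    refine intervalIntegral.norm_integral_le_of_norm_le_const fun y hyy => ?_
    rw [Set.uIoc_of_le hy] at hyy
    have := hb (s * T) y hyy.1.le hyy.2
    rwa [abs_mul, hs, one_mul] at this
  have s1 := side 1 (by simp)
  have s2 := side (-1) (by simp)
  have hrect : ∀ T : ℝ, (∫ x in (-T)..T, f (x + y₁ * Complex.I))
      - (∫ x in (-T)..T, f (x + y₂ * Complex.I))
      = Complex.I • (∫ y in y₁..y₂, f ((-1 * T : ℝ) + y * Complex.I))
        - Complex.I • (∫ y in y₁..y₂, f ((1 * T : ℝ) + y * Complex.I)) := by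
    intro T
    have := Complex.integral_boundary_rect_eq_zero_of_differentiableOn f (⟨-T, y₁⟩) (⟨T, y₂⟩)
      (fun z hz => by
        have hz2 := hz.2
        simp only [Set.mem_preimage, Set.uIcc_of_le hy, Set.mem_Icc] at hz2
        exact (hf z hz2.1 hz2.2).differentiableWithinAt)
    simp only at this
    rw [show (-1 * T : ℝ) = -T by ring, one_mul]
    linear_combination this
  have hlim := t1.sub t2
  have hlim2 : Tendsto (fun T : ℝ => (∫ x in (-T)..T, f (x + y₁ * Complex.I))
      - (∫ x in (-T)..T, f (x + y₂ * Complex.I))) atTop (𝓝 0) := by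
    simp_rw [hrect]
    simpa using (s2.const_smul Complex.I).sub (s1.const_smul Complex.I)
  exact sub_eq_zero.1 (tendsto_nhds_unique hlim hlim2)

/-- The Fourier-Laplace transform of the logistic function. -/
theorem integral_exp_mul_div_one_add_exp {u : ℂ} (h0 : 0 < u.re) (h1 : u.re < 1) :
    ∫ t : ℝ, Complex.exp (u * t) / (1 + Complex.exp t) = π / Complex.sin (π * u) := by
  have hB := Complex.Gamma_mul_Gamma_eq_betaIntegral (s := u) (t := 1 - u) h0 (by simpa using h1)
  rw [Complex.Gamma_mul_Gamma_one_sub, add_sub_cancel, Complex.Gamma_one, one_mul] at hB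
  rw [hB, Complex.betaIntegral, intervalIntegral.integral_of_le zero_le_one,
    integral_Ioc_eq_integral_Ioo, ← Real.range_sigmoid, ← Set.image_univ,
    integral_image_eq_integral_abs_deriv_smul MeasurableSet.univ
      (fun x _ => (Real.hasDerivAt_sigmoid x).hasDerivWithinAt) Real.sigmoid_injective.injOn,
    setIntegral_univ]
  refine integral_congr_ae (.of_forall fun t => ?_)
  simp only
  have hp := Real.sigmoid_pos t
  have hq : 0 < 1 - Real.sigmoid t := sub_pos.2 (Real.sigmoid_lt_one t)
  have hp' : (Real.sigmoid t : ℂ) ≠ 0 := by exact_mod_cast hp.ne'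
  have hq' : (1 - Real.sigmoid t : ℂ) ≠ 0 := by exact_mod_cast hq.ne'
  rw [abs_of_pos (mul_pos hp hq), Complex.real_smul]
  have hs : Real.sigmoid t = Real.exp t * (1 - Real.sigmoid t) := by
    rw [Real.sigmoid_def, Real.exp_neg]
    have := Real.exp_pos t
    field_simp
    ring
  have e1 : (Real.sigmoid t : ℂ) ^ (u - 1) * (1 - Real.sigmoid t : ℂ) ^ (1 - u - 1)
      = Complex.exp (u * t) * Complex.exp (-t) * (1 - Real.sigmoid t : ℂ)⁻¹ := by
    have e2 : (Real.sigmoid t : ℂ) = (Real.exp t : ℝ) * ((1 - Real.sigmoid t : ℝ) : ℂ) := by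
      exact_mod_cast hs
    have e3 : (1 - Real.sigmoid t : ℂ) = ((1 - Real.sigmoid t : ℝ) : ℂ) := by push_cast; rfl
    rw [e3]
    conv_lhs => rw [e2]
    rw [Complex.mul_cpow_ofReal_nonneg (Real.exp_pos t).le hq.le, mul_assoc,
      ← Complex.cpow_add _ _ (by exact_mod_cast hq.ne'),
      show u - 1 + (1 - u - 1) = -1 by ring, Complex.cpow_neg_one, Complex.cpow_def_of_ne_zero
        (by exact_mod_cast (Real.exp_pos t).ne'), ← Complex.ofReal_log (Real.exp_pos t).le,
      Real.log_exp, ← Complex.exp_add]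
    ring_nf
  rw [e1]
  have hs' : (Real.sigmoid t : ℂ) = Complex.exp t * (1 - Real.sigmoid t) := by
    exact_mod_cast hs
  have he : (1 + Complex.exp t : ℂ) * (1 - Real.sigmoid t) = 1 := by
    linear_combination -hs'
  have he' : (1 + Complex.exp t : ℂ) ≠ 0 := left_ne_zero_of_mul_eq_one he
  rw [div_eq_iff he', Complex.exp_neg]
  push_cast
  have := Complex.exp_ne_zero t
  field_simp
  linear_combination (Complex.exp t - 1) * hs' + (Complex.exp t) * he

/-- The Fourier-Laplace transform of the hyperbolic secant. -/
theorem integral_exp_mul_div_cosh {ζ : ℂ} (h0 : -1 < ζ.re) (h1 : ζ.re < 1) :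
    ∫ t : ℝ, Complex.exp (ζ * t) / Complex.cosh t = π / Complex.cos (π * ζ / 2) := by
  have h := integral_exp_mul_div_one_add_exp (u := (1 + ζ) / 2)
    (by simp; linarith) (by simp; linarith)
  have hs : Complex.sin (π * ((1 + ζ) / 2)) = Complex.cos (π * ζ / 2) := by
    rw [← Complex.cos_sub_pi_div_two]
    congr 1
    ring
  rw [hs] at h
  have h2 := Measure.integral_comp_mul_left
    (fun t : ℝ => Complex.exp ((1 + ζ) / 2 * t) / (1 + Complex.exp t)) 2
  rw [h, abs_of_pos (by norm_num), Complex.real_smul] at h2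
  have h3 : ∀ t : ℝ, Complex.exp ((1 + ζ) / 2 * ((2 * t : ℝ) : ℂ)) /
      (1 + Complex.exp ((2 * t : ℝ) : ℂ)) = 1 / 2 * (Complex.exp (ζ * t) / Complex.cosh t) := by
    intro t
    have hc : Complex.cosh t ≠ 0 := by exact_mod_cast (Real.cosh_pos t).ne'
    have e : 1 + Complex.exp ((2 * t : ℝ) : ℂ) = 2 * Complex.exp t * Complex.cosh t := by
      rw [mul_assoc, mul_left_comm, Complex.two_cosh, mul_add, ← Complex.exp_add, ← Complex.exp_add]
      push_cast
      rw [add_neg_cancel, Complex.exp_zero, two_mul, add_comm]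
    have e2 : Complex.exp ((1 + ζ) / 2 * ((2 * t : ℝ) : ℂ)) = Complex.exp t * Complex.exp (ζ * t) := by
      rw [← Complex.exp_add]
      push_cast
      ring_nf
    rw [e, e2]
    have := Complex.exp_ne_zero t
    field_simp
  simp_rw [h3] at h2
  rw [integral_const_mul] at h2
  push_cast at h2
  linear_combination 2 * h2

/-- The logarithm of Faddeev's quantum dilogarithm in the strip `|Im z| < Im c_𝖻`. -/
def logPhi (b : ℝ) (z : ℂ) : ℂ :=
  ∫ t : ℝ, phiKer b z (t + Complex.I * (π * min b b⁻¹ / 2))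

theorem PhiS_eq_exp (b : ℝ) (z : ℂ) : PhiS b z = Complex.exp (logPhi b z) := rfl

/-- The point with real part `t` on the integration contour, for `b ≤ 1`. -/
def contourPt (b t : ℝ) : ℂ := t + Complex.I * (π * b / 2)

/-- The `z`-independent factor of the kernel of `logPhi`, for `b ≤ 1`. -/
def logPhiAmp (b t : ℝ) : ℂ :=
  (4 * Complex.sinh (contourPt b t * b) * Complex.sinh (contourPt b t / b) * contourPt b t)⁻¹

/-- The `z`-independent factor of the kernel of `logPhi (z - i b / 2) - logPhi (z + i b / 2)`. -/
def logPhiDiffAmp (b t : ℝ) : ℂ :=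
  -(2 * Complex.sinh (contourPt b t / b) * contourPt b t)⁻¹

theorem Real.exp_abs_le_two_mul_cosh (x : ℝ) : Real.exp |x| ≤ 2 * Real.cosh x := by
  rw [← Real.cosh_abs, Real.cosh_eq]
  linarith [Real.exp_pos (-|x|)]

theorem Complex.sin_mul_cosh_le_norm_sinh (x y : ℝ) :
    Real.sin y * Real.cosh x ≤ ‖Complex.sinh (x + Complex.I * y)‖ := by
  have : (Complex.sinh (x + Complex.I * y)).im = Real.sin y * Real.cosh x := by
    rw [Complex.sinh_add, mul_comm Complex.I, Complex.sinh_mul_I, Complex.cosh_mul_I]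
    rw [← Complex.ofReal_sinh, ← Complex.ofReal_cosh, ← Complex.ofReal_sin, ← Complex.ofReal_cos]
    simp [mul_comm, Complex.sin_ofReal_re]
  rw [← this]
  exact (le_abs_self _).trans (Complex.abs_im_le_norm _)

section
variable {b : ℝ}

theorem le_norm_contourPt (t : ℝ) : π * b / 2 ≤ ‖contourPt b t‖ := by
  have h : (contourPt b t).im = π * b / 2 := by
    simp [contourPt]
  rw [← h]
  exact (le_abs_self _).trans (Complex.abs_im_le_norm _)

theorem contourPt_ne_zero (hb : 0 < b) (t : ℝ) : contourPt b t ≠ 0 := by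
  have := le_norm_contourPt (b := b) t
  have h2 : 0 < π * b / 2 := by positivity
  exact norm_pos_iff.1 (h2.trans_le this)

theorem sinh_contourPt_div (hb : 0 < b) (t : ℝ) :
    Complex.sinh (contourPt b t / b) = Complex.I * Complex.cosh ((t / b : ℝ)) := by
  have hb' : (b : ℂ) ≠ 0 := by exact_mod_cast hb.ne'
  have e : contourPt b t / b = ((t / b : ℝ) : ℂ) + (π / 2 : ℂ) * Complex.I := by
    simp only [contourPt]
    push_cast
    field_simp
  rw [e, Complex.sinh_add, Complex.sinh_mul_I, Complex.cosh_mul_I, Complex.sin_pi_div_two,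
    Complex.cos_pi_div_two]
  ring

theorem exp_le_norm_sinh_contourPt_div (hb : 0 < b) (t : ℝ) :
    Real.exp (b⁻¹ * |t|) / 2 ≤ ‖Complex.sinh (contourPt b t / b)‖ := by
  rw [sinh_contourPt_div hb, norm_mul, Complex.norm_I, one_mul, ← Complex.ofReal_cosh,
    Complex.norm_real, Real.norm_of_nonneg (Real.cosh_pos _).le]
  have := Real.exp_abs_le_two_mul_cosh (t / b)
  rw [abs_div, abs_of_pos hb, div_eq_inv_mul] at this
  linarith

theorem exp_le_norm_sinh_contourPt_mul (hb : 0 < b) (hb1 : b ≤ 1) (t : ℝ) :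
    b ^ 2 * Real.exp (b * |t|) / 2 ≤ ‖Complex.sinh (contourPt b t * b)‖ := by
  have h1 := Complex.sin_mul_cosh_le_norm_sinh (t * b) (π * b ^ 2 / 2)
  have e : contourPt b t * b = ((t * b : ℝ) : ℂ) + Complex.I * (π * b ^ 2 / 2 : ℝ) := by
    simp only [contourPt]; push_cast; ring
  rw [e]
  refine le_trans ?_ h1
  have hb2 : b ^ 2 ≤ 1 := pow_le_one₀ hb.le hb1
  have hs : b ^ 2 ≤ Real.sin (π * b ^ 2 / 2) := by
    have := Real.mul_le_sin (x := π * b ^ 2 / 2) (by positivity) (by nlinarith [Real.pi_pos])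
    refine le_trans (le_of_eq ?_) this
    field_simp
  have hc := Real.exp_abs_le_two_mul_cosh (t * b)
  rw [abs_mul, abs_of_pos hb, mul_comm |t|] at hc
  calc b ^ 2 * Real.exp (b * |t|) / 2 = b ^ 2 * (Real.exp (b * |t|) / 2) := by ring
    _ ≤ Real.sin (π * b ^ 2 / 2) * Real.cosh (t * b) := by
      gcongr
      · exact (by positivity : 0 ≤ b ^ 2).trans hs
      · linarith

theorem norm_logPhiAmp_le (hb : 0 < b) (hb1 : b ≤ 1) (t : ℝ) :
    ‖logPhiAmp b t‖ ≤ 2 / (π * b ^ 3) * Real.exp (-((b + b⁻¹) * |t|)) := by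
  have h1 := le_norm_contourPt (b := b) t
  have h2 := exp_le_norm_sinh_contourPt_div hb t
  have h3 := exp_le_norm_sinh_contourPt_mul hb hb1 t
  rw [logPhiAmp, norm_inv, norm_mul, norm_mul, norm_mul]
  calc (‖(4 : ℂ)‖ * ‖Complex.sinh (contourPt b t * b)‖ * ‖Complex.sinh (contourPt b t / b)‖
        * ‖contourPt b t‖)⁻¹
      ≤ (4 * (b ^ 2 * Real.exp (b * |t|) / 2) * (Real.exp (b⁻¹ * |t|) / 2) * (π * b / 2))⁻¹ := by
        rw [show ‖(4 : ℂ)‖ = 4 by simp]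
        gcongr
    _ = _ := by
      rw [add_mul, neg_add, Real.exp_add, Real.exp_neg, Real.exp_neg]
      field_simp
      norm_num

theorem norm_logPhiDiffAmp_le (hb : 0 < b) (t : ℝ) :
    ‖logPhiDiffAmp b t‖ ≤ 2 / (π * b) * Real.exp (-(b⁻¹ * |t|)) := by
  have h1 := le_norm_contourPt (b := b) t
  have h2 := exp_le_norm_sinh_contourPt_div hb t
  rw [logPhiDiffAmp, norm_neg, norm_inv, norm_mul, norm_mul]
  calc (‖(2 : ℂ)‖ * ‖Complex.sinh (contourPt b t / b)‖ * ‖contourPt b t‖)⁻¹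
      ≤ (2 * (Real.exp (b⁻¹ * |t|) / 2) * (π * b / 2))⁻¹ := by
        rw [show ‖(2 : ℂ)‖ = 2 by simp]
        gcongr
    _ = _ := by
      rw [Real.exp_neg]
      field_simp

theorem exp_neg_mul_abs_le {q : ℝ} (hq : 0 ≤ q) (t : ℝ) :
    Real.exp (-(q * |t|)) ≤ Real.exp (-q * t) ∧ Real.exp (-(q * |t|)) ≤ Real.exp (-(-q) * t) := by
  constructor <;> gcongr <;> nlinarith [le_abs_self t, neg_abs_le t]

theorem sinh_contourPt_div_ne_zero (hb : 0 < b) (t : ℝ) :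
    Complex.sinh (contourPt b t / b) ≠ 0 :=
  norm_pos_iff.1 ((by positivity : 0 < Real.exp (b⁻¹ * |t|) / 2).trans_le
    (exp_le_norm_sinh_contourPt_div hb t))

theorem sinh_contourPt_mul_ne_zero (hb : 0 < b) (hb1 : b ≤ 1) (t : ℝ) :
    Complex.sinh (contourPt b t * b) ≠ 0 :=
  norm_pos_iff.1 ((by positivity : 0 < b ^ 2 * Real.exp (b * |t|) / 2).trans_le
    (exp_le_norm_sinh_contourPt_mul hb hb1 t))

theorem continuous_logPhiAmp (hb : 0 < b) (hb1 : b ≤ 1) : Continuous (logPhiAmp b) := by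
  unfold logPhiAmp
  refine Continuous.inv₀ (by unfold contourPt; fun_prop) fun t => ?_
  exact mul_ne_zero (mul_ne_zero (mul_ne_zero (by norm_num) (sinh_contourPt_mul_ne_zero hb hb1 t))
    (sinh_contourPt_div_ne_zero hb t)) (contourPt_ne_zero hb t)

theorem continuous_logPhiDiffAmp (hb : 0 < b) : Continuous (logPhiDiffAmp b) := by
  unfold logPhiDiffAmp
  refine (Continuous.inv₀ (by unfold contourPt; fun_prop) fun t => ?_).neg
  exact mul_ne_zero (mul_ne_zero (by norm_num) (sinh_contourPt_div_ne_zero hb t))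
    (contourPt_ne_zero hb t)

theorem norm_logPhiAmp_le_left (hb : 0 < b) (hb1 : b ≤ 1) (t : ℝ) :
    ‖logPhiAmp b t‖ ≤ 2 / (π * b ^ 3) * Real.exp (-(-(b + b⁻¹)) * t) := by
  refine (norm_logPhiAmp_le hb hb1 t).trans ?_
  gcongr
  exact Real.exp_le_exp.1 (exp_neg_mul_abs_le (by positivity) t).2

theorem norm_logPhiAmp_le_right (hb : 0 < b) (hb1 : b ≤ 1) (t : ℝ) :
    ‖logPhiAmp b t‖ ≤ 2 / (π * b ^ 3) * Real.exp (-(b + b⁻¹) * t) := by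
  refine (norm_logPhiAmp_le hb hb1 t).trans ?_
  gcongr
  exact Real.exp_le_exp.1 (exp_neg_mul_abs_le (by positivity) t).1

theorem norm_logPhiDiffAmp_le_left (hb : 0 < b) (t : ℝ) :
    ‖logPhiDiffAmp b t‖ ≤ 2 / (π * b) * Real.exp (-(-b⁻¹) * t) := by
  refine (norm_logPhiDiffAmp_le hb t).trans ?_
  gcongr
  exact Real.exp_le_exp.1 (exp_neg_mul_abs_le (by positivity) t).2

theorem norm_logPhiDiffAmp_le_right (hb : 0 < b) (t : ℝ) :
    ‖logPhiDiffAmp b t‖ ≤ 2 / (π * b) * Real.exp (-b⁻¹ * t) := by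
  refine (norm_logPhiDiffAmp_le hb t).trans ?_
  gcongr
  exact Real.exp_le_exp.1 (exp_neg_mul_abs_le (by positivity) t).1

theorem phiKer_eq (hb : 0 < b) (hb1 : b ≤ 1) (z : ℂ) (t : ℝ) :
    phiKer b z (t + Complex.I * (π * min b b⁻¹ / 2)) =
      Complex.exp (π * b * z) * (logPhiAmp b t * Complex.exp (-2 * Complex.I * z * t)) := by
  have hmin : min b b⁻¹ = b := min_eq_left (hb1.trans ((one_le_inv₀ hb).2 hb1))
  have e' : (t + Complex.I * (π * (min b b⁻¹ : ℝ) / 2) : ℂ) = contourPt b t := by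
    rw [hmin, contourPt]
  rw [e', phiKer, logPhiAmp, div_eq_mul_inv, mul_left_comm, ← Complex.exp_add, mul_comm]
  congr 2
  simp only [contourPt]
  linear_combination (-z * π * b) * Complex.I_sq

theorem logPhi_eq_laplace (hb : 0 < b) (hb1 : b ≤ 1) (z : ℂ) :
    logPhi b z = Complex.exp (π * b * z) *
      ∫ t : ℝ, logPhiAmp b t * Complex.exp (-2 * Complex.I * z * t) := by
  rw [logPhi, ← integral_const_mul]
  simp_rw [phiKer_eq hb hb1]

theorem re_neg_two_I_mul (z : ℂ) : (-2 * Complex.I * z).re = 2 * z.im := by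
  simp

theorem norm_logPhi_le (hb : 0 < b) (hb1 : b ≤ 1) {z : ℂ} {δ : ℝ} (hδ : 0 < δ)
    (hz : 2 * |z.im| + δ ≤ b + b⁻¹) :
    ‖logPhi b z‖ ≤ Real.exp (π * b * z.re) * (4 / (π * b ^ 3 * δ)) := by
  rw [logPhi_eq_laplace hb hb1, norm_mul, Complex.norm_exp]
  have e : (π * b * z : ℂ).re = π * b * z.re := by
    rw [← Complex.ofReal_mul, Complex.re_ofReal_mul]
  rw [e]
  gcongr
  have := norm_laplace_le (norm_logPhiAmp_le_left hb hb1) (norm_logPhiAmp_le_right hb hb1) hδ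
    (z := -2 * Complex.I * z) (by rw [re_neg_two_I_mul]; linarith [neg_abs_le z.im])
    (by rw [re_neg_two_I_mul]; linarith [le_abs_self z.im])
  refine this.trans_eq ?_
  field_simp
  norm_num

theorem differentiableAt_logPhi (hb : 0 < b) (hb1 : b ≤ 1) {z : ℂ} (hz : 2 * |z.im| < b + b⁻¹) :
    DifferentiableAt ℂ (logPhi b) z := by
  have h := (hasDerivAt_laplace (continuous_logPhiAmp hb hb1) (norm_logPhiAmp_le_left hb hb1)
    (norm_logPhiAmp_le_right hb hb1) (z := -2 * Complex.I * z)
    (by rw [re_neg_two_I_mul]; linarith [neg_abs_le z.im])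
    (by rw [re_neg_two_I_mul]; linarith [le_abs_self z.im])).2.differentiableAt
  rw [funext (logPhi_eq_laplace hb hb1)]
  refine DifferentiableAt.mul (by fun_prop) ?_
  exact h.comp z (f := fun z => -2 * Complex.I * z) (by fun_prop)

theorem conj_logPhi (b : ℝ) (z : ℂ) :
    (starRingEnd ℂ) (logPhi b z) = -logPhi b ((starRingEnd ℂ) z) := by
  have h : ∀ t : ℝ, (starRingEnd ℂ) (phiKer b z (t + Complex.I * (π * min b b⁻¹ / 2))) =
      -phiKer b ((starRingEnd ℂ) z) (((-t : ℝ) : ℂ) + Complex.I * (π * min b b⁻¹ / 2)) := by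
    intro t
    set m : ℝ := min b b⁻¹
    have e : ((-t : ℝ) : ℂ) + Complex.I * (π * m / 2) =
        -(starRingEnd ℂ) (t + Complex.I * (π * m / 2)) := by
      simp [map_ofNat]
      ring
    rw [e]
    simp only [phiKer, map_div₀, map_mul, ← Complex.exp_conj, ← Complex.sinh_conj, neg_mul,
      neg_div, Complex.sinh_neg, mul_neg, neg_neg, map_neg, Complex.conj_I, Complex.conj_ofReal,
      div_neg, map_ofNat]
  rw [logPhi, ← integral_conj]
  simp_rw [h]
  rw [integral_neg, logPhi]
  congr 1
  exact integral_neg_eq_self (fun t : ℝ => phiKer b ((starRingEnd ℂ) z)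
    ((t : ℂ) + Complex.I * (π * min b b⁻¹ / 2))) volume

end

section
variable {b : ℝ}

/-- The difference `logPhi (z - i b / 2) - logPhi (z + i b / 2)` as a Laplace transform. -/
def logPhiShift (b : ℝ) (z : ℂ) : ℂ :=
  Complex.exp (π * b * z) * ∫ t : ℝ, logPhiDiffAmp b t * Complex.exp (-2 * Complex.I * z * t)

theorem logPhiAmp_mul_exp_sub_exp (hb : 0 < b) (hb1 : b ≤ 1) (t : ℝ) :
    logPhiAmp b t * (Complex.exp (-(contourPt b t * b)) - Complex.exp (contourPt b t * b)) =
      logPhiDiffAmp b t := by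
  have h1 := sinh_contourPt_mul_ne_zero hb hb1 t
  have h2 := sinh_contourPt_div_ne_zero hb t
  have h3 := contourPt_ne_zero hb t
  have e : Complex.exp (-(contourPt b t * b)) - Complex.exp (contourPt b t * b) =
      -2 * Complex.sinh (contourPt b t * b) := by
    rw [neg_mul, Complex.two_sinh]; ring
  rw [e, logPhiAmp, logPhiDiffAmp]
  generalize Complex.sinh (contourPt b t * b) = A at *
  generalize Complex.sinh (contourPt b t / b) = B at *
  field_simp
  norm_num

theorem two_mul_abs_im_shift_lt (hb : 0 < b) {z : ℂ} (hz : 2 * |z.im| < b⁻¹) :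
    2 * |(z - Complex.I * b / 2).im| < b + b⁻¹ ∧ 2 * |(z + Complex.I * b / 2).im| < b + b⁻¹ := by
  have e1 : (z - Complex.I * b / 2).im = z.im - b / 2 := by simp
  have e2 : (z + Complex.I * b / 2).im = z.im + b / 2 := by simp
  rw [e1, e2]
  obtain ⟨h1, h2⟩ := abs_lt.1 (show |z.im| < b⁻¹ / 2 by linarith)
  constructor
  · have : |z.im - b / 2| < (b + b⁻¹) / 2 := abs_lt.2 ⟨by linarith, by linarith⟩
    linarith
  · have : |z.im + b / 2| < (b + b⁻¹) / 2 := abs_lt.2 ⟨by linarith, by linarith⟩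
    linarith

theorem integrable_logPhi_kernel (hb : 0 < b) (hb1 : b ≤ 1) {z : ℂ}
    (hz : 2 * |z.im| < b + b⁻¹) :
    Integrable fun t : ℝ => logPhiAmp b t * Complex.exp (-2 * Complex.I * z * t) :=
  integrable_laplace (continuous_logPhiAmp hb hb1) (norm_logPhiAmp_le_left hb hb1)
    (norm_logPhiAmp_le_right hb hb1)
    (by rw [re_neg_two_I_mul]; linarith [neg_abs_le z.im])
    (by rw [re_neg_two_I_mul]; linarith [le_abs_self z.im])

theorem logPhi_sub_logPhi (hb : 0 < b) (hb1 : b ≤ 1) {z : ℂ} (hz : 2 * |z.im| < b⁻¹) :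
    logPhi b (z - Complex.I * b / 2) - logPhi b (z + Complex.I * b / 2) = logPhiShift b z := by
  obtain ⟨h1, h2⟩ := two_mul_abs_im_shift_lt hb hz
  rw [logPhi_eq_laplace hb hb1, logPhi_eq_laplace hb hb1, logPhiShift, ← integral_const_mul,
    ← integral_const_mul, ← integral_const_mul, ← integral_sub
      ((integrable_logPhi_kernel hb hb1 h1).const_mul _)
      ((integrable_logPhi_kernel hb hb1 h2).const_mul _)]
  congr 1
  ext t
  rw [← logPhiAmp_mul_exp_sub_exp hb hb1]
  have e1 : Complex.exp (π * b * (z - Complex.I * b / 2)) *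
      (logPhiAmp b t * Complex.exp (-2 * Complex.I * (z - Complex.I * b / 2) * t)) =
      logPhiAmp b t * (Complex.exp (π * b * z) * (Complex.exp (-2 * Complex.I * z * t) *
        Complex.exp (-(contourPt b t * b)))) := by
    rw [mul_left_comm, ← Complex.exp_add, ← Complex.exp_add, ← Complex.exp_add]
    congr 2
    simp only [contourPt]
    linear_combination (t * b : ℂ) * Complex.I_sq
  have e2 : Complex.exp (π * b * (z + Complex.I * b / 2)) *
      (logPhiAmp b t * Complex.exp (-2 * Complex.I * (z + Complex.I * b / 2) * t)) =
      logPhiAmp b t * (Complex.exp (π * b * z) * (Complex.exp (-2 * Complex.I * z * t) *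
        Complex.exp (contourPt b t * b))) := by
    rw [mul_left_comm, ← Complex.exp_add, ← Complex.exp_add, ← Complex.exp_add]
    congr 2
    simp only [contourPt]
    linear_combination (-t * b : ℂ) * Complex.I_sq
  rw [e1, e2]
  ring

theorem cosh_pi_mul_ne_zero (hb : 0 < b) {z : ℂ} (hz : 2 * |z.im| < b⁻¹) :
    Complex.cosh (π * b * z) ≠ 0 := by
  have e : (Complex.cosh (π * b * z)).re = Real.cosh (π * b * z.re) * Real.cos (π * b * z.im) := by
    conv_lhs => rw [← Complex.re_add_im z]
    rw [mul_add, Complex.cosh_add, ← mul_assoc, Complex.sinh_mul_I, Complex.cosh_mul_I]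
    rw [← Complex.ofReal_mul, ← Complex.ofReal_mul, ← Complex.ofReal_mul, ← Complex.ofReal_sinh,
      ← Complex.ofReal_cosh, ← Complex.ofReal_sin, ← Complex.ofReal_cos, ← mul_assoc,
      ← Complex.ofReal_mul, ← Complex.ofReal_mul, Complex.add_re, Complex.re_ofReal_mul,
      Complex.ofReal_re, Complex.I_re, mul_zero, add_zero]
  have hpos : 0 < (Complex.cosh (π * b * z)).re := by
    rw [e]
    refine mul_pos (Real.cosh_pos _) (Real.cos_pos_of_mem_Ioo ?_)
    have h : |π * b * z.im| < π / 2 := by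
      rw [abs_mul, abs_of_pos (by positivity : 0 < π * b)]
      calc π * b * |z.im| < π * b * (b⁻¹ / 2) := by gcongr; linarith
        _ = π / 2 := by field_simp
    exact ⟨(abs_lt.1 h).1, (abs_lt.1 h).2⟩
  intro h0
  simp [h0] at hpos

theorem hasDerivAt_logPhiShift (hb : 0 < b) {z : ℂ} (hz : 2 * |z.im| < b⁻¹) :
    HasDerivAt (logPhiShift b)
      (π * b * Complex.exp (π * b * z) / Complex.cosh (π * b * z)) z := by
  have hl : -b⁻¹ < (-2 * Complex.I * z).re := by
    rw [re_neg_two_I_mul]; linarith [neg_abs_le z.im]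
  have hu : (-2 * Complex.I * z).re < b⁻¹ := by
    rw [re_neg_two_I_mul]; linarith [le_abs_self z.im]
  obtain ⟨hi, hd⟩ := hasDerivAt_laplace (continuous_logPhiDiffAmp hb)
    (norm_logPhiDiffAmp_le_left hb) (norm_logPhiDiffAmp_le_right hb) hl hu
  have hi0 := integrable_laplace (continuous_logPhiDiffAmp hb)
    (norm_logPhiDiffAmp_le_left hb) (norm_logPhiDiffAmp_le_right hb) hl hu
  have hlin : HasDerivAt (fun z : ℂ => -2 * Complex.I * z) (-2 * Complex.I) z := by
    simpa using (hasDerivAt_id z).const_mul (-2 * Complex.I)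
  have hlin' : HasDerivAt (fun z : ℂ => Complex.exp (π * b * z))
      (Complex.exp (π * b * z) * (π * b)) z := by
    simpa using ((hasDerivAt_id z).const_mul (π * b : ℂ)).cexp
  have key := hlin'.mul (hd.comp z hlin)
  refine key.congr_deriv ?_
  clear key
  have hmain : ∫ t : ℝ, Complex.exp (-2 * Complex.I * z * t) / Complex.cosh ((t / b : ℝ)) =
      π * b / Complex.cosh (π * b * z) := by
    have h1 := integral_exp_mul_div_cosh (ζ := -2 * Complex.I * z * b)
      (by rw [Complex.re_mul_ofReal]
          calc (-1 : ℝ) = -b⁻¹ * b := by field_simp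
            _ < _ := by gcongr)
      (by rw [Complex.re_mul_ofReal]
          calc _ < b⁻¹ * b := by gcongr
            _ = 1 := by field_simp)
    have h2 := Measure.integral_comp_div
      (fun s : ℝ => Complex.exp (-2 * Complex.I * z * b * s) / Complex.cosh s) b
    rw [h1, abs_of_pos hb] at h2
    have hb' : (b : ℂ) ≠ 0 := by exact_mod_cast hb.ne'
    have e : ∀ t : ℝ, -2 * Complex.I * z * b * ((t / b : ℝ) : ℂ) = -2 * Complex.I * z * t := by
      intro t; push_cast; field_simp
    simp_rw [e] at h2
    rw [h2, Complex.real_smul]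
    have e2 : (π * (-2 * Complex.I * z * b) / 2 : ℂ) = -(π * b * z * Complex.I) := by ring
    rw [e2, Complex.cos_neg, Complex.cos_mul_I]
    ring
  have e1 : ∀ t : ℝ, Complex.exp (-2 * Complex.I * z * t) / Complex.cosh ((t / b : ℝ)) =
      π * b * (logPhiDiffAmp b t * Complex.exp (-2 * Complex.I * z * t)) +
      -2 * Complex.I * (t * (logPhiDiffAmp b t * Complex.exp (-2 * Complex.I * z * t))) := by
    intro t
    have h2 := sinh_contourPt_div_ne_zero hb t
    have h3 := contourPt_ne_zero hb t
    have hD : logPhiDiffAmp b t = Complex.I / (2 * Complex.cosh ((t / b : ℝ)) * contourPt b t) := by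
      rw [logPhiDiffAmp, sinh_contourPt_div hb]
      rw [sinh_contourPt_div hb] at h2
      have h4 := right_ne_zero_of_mul h2
      field_simp
      rw [Complex.I_sq]
    have hw : (π * b : ℂ) + -2 * Complex.I * t = -2 * Complex.I * contourPt b t := by
      simp only [contourPt]
      linear_combination (π * b : ℂ) * Complex.I_sq
    rw [sinh_contourPt_div hb] at h2
    have h4 := right_ne_zero_of_mul h2
    calc _ = (-2 * Complex.I * contourPt b t) *
          (logPhiDiffAmp b t * Complex.exp (-2 * Complex.I * z * t)) := by
          rw [hD]
          field_simp
          rw [Complex.I_sq, neg_neg]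
      _ = _ := by rw [← hw]; ring
  rw [integral_congr_ae (.of_forall e1), integral_add (hi0.const_mul _) (hi.const_mul _),
    integral_const_mul, integral_const_mul] at hmain
  simp only [Function.comp_apply]
  calc _ = Complex.exp (π * b * z) * (π * b / Complex.cosh (π * b * z)) := by
        rw [← hmain]; ring
    _ = _ := by ring

theorem isOpen_setOf_two_mul_abs_im_lt (r : ℝ) : IsOpen {z : ℂ | 2 * |z.im| < r} :=
  isOpen_lt (by fun_prop) continuous_const

theorem isPreconnected_setOf_two_mul_abs_im_lt (r : ℝ) :
    IsPreconnected {z : ℂ | 2 * |z.im| < r} := by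
  have : {z : ℂ | 2 * |z.im| < r} = Complex.imLm ⁻¹' Set.Ioo (-(r / 2)) (r / 2) := by
    ext z
    simp only [Set.mem_ofPred_eq, Set.mem_preimage, Set.mem_Ioo, ← abs_lt]
    constructor <;> intro h
    · exact (by linarith : |z.im| < r / 2)
    · have h' : |z.im| < r / 2 := h
      linarith
  rw [this]
  exact ((convex_Ioo _ _).linear_preimage _).isPreconnected

theorem norm_logPhiShift_ofReal_le (hb : 0 < b) (x : ℝ) :
    ‖logPhiShift b x‖ ≤ Real.exp (π * b * x) * (4 / π) := by
  rw [logPhiShift, norm_mul, Complex.norm_exp]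
  have e : (π * b * x : ℂ).re = π * b * x := by
    rw [← Complex.ofReal_mul, Complex.re_ofReal_mul, Complex.ofReal_re]
  rw [e]
  gcongr
  have := norm_laplace_le (norm_logPhiDiffAmp_le_left hb) (norm_logPhiDiffAmp_le_right hb)
    (inv_pos.2 hb) (z := -2 * Complex.I * x) (by rw [re_neg_two_I_mul]; simp)
    (by rw [re_neg_two_I_mul]; simp)
  refine this.trans_eq ?_
  field_simp
  norm_num

theorem exp_logPhiShift (hb : 0 < b) {z : ℂ} (hz : 2 * |z.im| < b⁻¹) :
    Complex.exp (logPhiShift b z) = 1 + Complex.exp (2 * π * b * z) := by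
  set H : ℂ → ℂ := fun z => Complex.exp (-logPhiShift b z) * (1 + Complex.exp (2 * π * b * z))
  have hH : ∀ z : ℂ, 2 * |z.im| < b⁻¹ → HasDerivAt H 0 z := by
    intro z hz
    have h1 := (hasDerivAt_logPhiShift hb hz).neg.cexp
    have h2 : HasDerivAt (fun z : ℂ => 1 + Complex.exp (2 * π * b * z))
        (Complex.exp (2 * π * b * z) * (2 * π * b)) z := by
      simpa using (((hasDerivAt_id z).const_mul (2 * π * b : ℂ)).cexp).const_add 1
    refine (h1.mul h2).congr_deriv ?_
    have hc := cosh_pi_mul_ne_zero hb hz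
    have e1 : Complex.exp (2 * π * b * z) = Complex.exp (π * b * z) * Complex.exp (π * b * z) := by
      rw [← Complex.exp_add]; ring_nf
    have e2 : 1 + Complex.exp (2 * π * b * z) =
        2 * Complex.cosh (π * b * z) * Complex.exp (π * b * z) := by
      rw [Complex.two_cosh, add_mul, ← Complex.exp_add, ← Complex.exp_add, neg_add_cancel,
        Complex.exp_zero, add_comm]
      ring_nf
    simp only [Pi.neg_apply]
    rw [e2, e1]
    field_simp
    ring
  have hconst : ∀ x : ℝ, H x = H z := fun x =>
    (isOpen_setOf_two_mul_abs_im_lt b⁻¹).is_const_of_deriv_eq_zero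
      (isPreconnected_setOf_two_mul_abs_im_lt _)
      (fun w hw => (hH w hw).differentiableAt.differentiableWithinAt)
      (fun w hw => (hH w hw).deriv) (by simpa using hb) hz
  have hexp0 : Filter.Tendsto (fun x : ℝ => Real.exp (π * b * x)) Filter.atBot (nhds 0) :=
    Real.tendsto_exp_atBot.comp (Filter.tendsto_id.const_mul_atBot (by positivity))
  have hl0 : Filter.Tendsto (fun x : ℝ => logPhiShift b x) Filter.atBot (nhds 0) := by
    refine squeeze_zero_norm (norm_logPhiShift_ofReal_le hb) ?_
    simpa using hexp0.mul_const (4 / π)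
  have hexp0' : Filter.Tendsto (fun x : ℝ => Complex.exp (2 * π * b * x)) Filter.atBot (nhds 0) := by
    have h : Filter.Tendsto (fun x : ℝ => Real.exp (2 * π * b * x)) Filter.atBot (nhds 0) :=
      Real.tendsto_exp_atBot.comp (Filter.tendsto_id.const_mul_atBot (by positivity))
    have := (Complex.continuous_ofReal.tendsto 0).comp h
    refine (this.congr fun x => ?_).trans (by simp)
    simp
  have hlim : Filter.Tendsto (fun x : ℝ => H x) Filter.atBot (nhds 1) := by
    have := (hl0.neg.cexp).mul (hexp0'.const_add 1)
    simpa [H] using this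
  have h1 : H z = 1 := tendsto_nhds_unique
    ((tendsto_const_nhds (x := H z)).congr fun x => (hconst x).symm) hlim
  have h2 : Complex.exp (-logPhiShift b z) * (1 + Complex.exp (2 * π * b * z)) = 1 := h1
  rw [Complex.exp_neg] at h2
  have := Complex.exp_ne_zero (logPhiShift b z)
  field_simp at h2
  exact h2.symm

/-- The functional equation of the quantum dilogarithm, inside its strip of definition. -/
theorem exp_logPhi_sub (hb : 0 < b) (hb1 : b ≤ 1) {z : ℂ} (hz : 2 * |z.im| < b⁻¹) :
    Complex.exp (logPhi b (z - Complex.I * b / 2)) =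
      (1 + Complex.exp (2 * π * b * z)) * Complex.exp (logPhi b (z + Complex.I * b / 2)) := by
  rw [← exp_logPhiShift hb hz, ← logPhi_sub_logPhi hb hb1 hz, ← Complex.exp_add]
  ring_nf

theorem logPhiShift_sub_logPhiShift_neg (hb : 0 < b) {z : ℂ} (hz : 2 * |z.im| < b⁻¹) :
    logPhiShift b z - logPhiShift b (-z) = 2 * π * b * z := by
  set H : ℂ → ℂ := fun z => logPhiShift b z - logPhiShift b (-z) - 2 * π * b * z
  have hH : ∀ z : ℂ, 2 * |z.im| < b⁻¹ → HasDerivAt H 0 z := by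
    intro z hz
    have h1 := hasDerivAt_logPhiShift hb hz
    have h2 := (hasDerivAt_logPhiShift hb (z := -z) (by simpa using hz)).comp z (hasDerivAt_neg z)
    have h3 : HasDerivAt (fun z : ℂ => 2 * π * b * z) (2 * π * b) z := by
      simpa using (hasDerivAt_id z).const_mul (2 * π * b : ℂ)
    refine ((h1.sub h2).sub h3).congr_deriv ?_
    have hc := cosh_pi_mul_ne_zero hb hz
    rw [mul_neg (π * b : ℂ), Complex.cosh_neg]
    have e2 := Complex.two_cosh (π * b * z)
    field_simp
    linear_combination (-(π * b) : ℂ) * e2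
  have hconst : H z = H 0 :=
    (isOpen_setOf_two_mul_abs_im_lt b⁻¹).is_const_of_deriv_eq_zero
      (isPreconnected_setOf_two_mul_abs_im_lt _)
      (fun w hw => (hH w hw).differentiableAt.differentiableWithinAt)
      (fun w hw => (hH w hw).deriv) hz (by simpa using hb)
  simp only [H, neg_zero, sub_self, mul_zero] at hconst
  linear_combination hconst

/-- The inversion relation of the quantum dilogarithm. -/
theorem logPhi_add_logPhi_neg (hb : 0 < b) (hb1 : b ≤ 1) {z : ℂ} (hz : 2 * |z.im| < b + b⁻¹) :
    logPhi b z + logPhi b (-z) = π * Complex.I * z ^ 2 + 2 * logPhi b 0 := by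
  have hbi : 1 ≤ b⁻¹ := (one_le_inv₀ hb).2 hb1
  set R : ℂ → ℂ := fun z => logPhi b z + logPhi b (-z) - π * Complex.I * z ^ 2
  have hmem : ∀ p : ℂ, -((b + b⁻¹) / 2) < p.im → p.im < (b + b⁻¹) / 2 →
      2 * |p.im| < b + b⁻¹ := fun p h1 h2 => by
    have := abs_lt.2 ⟨h1, h2⟩
    linarith
  have hz' := abs_lt.1 (show |z.im| < (b + b⁻¹) / 2 by linarith)
  have key : R z = R 0 := by
    refine eq_of_strip_periodic (R := R) (α := -((b + b⁻¹) / 2)) (β := (b + b⁻¹) / 2)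
      (y₀ := -(b / 2)) (h := b) (κ := 3 * π / 2) (C := 2 * (4 / (π * b ^ 3 * b⁻¹)) + 3 * π)
      hb (by linarith) (by linarith) ?_ ?_ ?_ ?_ hz'.1 hz'.2 (by simp; positivity)
      (by simp; positivity)
    · rw [lt_div_iff₀ hb]
      nlinarith [Real.pi_pos]
    · intro p h1 h2
      have h := hmem p h1 h2
      have d1 := differentiableAt_logPhi hb hb1 h
      have d2 : DifferentiableAt ℂ (fun z => logPhi b (-z)) p :=
        DifferentiableAt.comp (g := logPhi b) p (differentiableAt_logPhi hb hb1 (by simpa using h))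
          differentiableAt_id.neg
      exact (d1.add d2).sub (by fun_prop)
    · intro p h1 h2
      have him : (p + Complex.I * b / 2).im = p.im + b / 2 := by simp
      have hq : 2 * |(p + Complex.I * b / 2).im| < b⁻¹ := by
        rw [him]
        have : |p.im + b / 2| < b⁻¹ / 2 := abs_lt.2 ⟨by linarith, by linarith⟩
        linarith
      have s1 := logPhi_sub_logPhi hb hb1 hq
      have s2 := logPhi_sub_logPhi hb hb1 (z := -(p + Complex.I * b / 2))
        (by rwa [Complex.neg_im, abs_neg])
      have s3 := logPhiShift_sub_logPhiShift_neg hb hq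
      have e1 : p + Complex.I * b / 2 - Complex.I * b / 2 = p := by ring
      have e2 : p + Complex.I * b / 2 + Complex.I * b / 2 = p + Complex.I * b := by ring
      have e3 : -(p + Complex.I * b / 2) - Complex.I * b / 2 = -(p + Complex.I * b) := by ring
      have e4 : -(p + Complex.I * b / 2) + Complex.I * b / 2 = -p := by ring
      rw [e1, e2] at s1
      rw [e3, e4] at s2
      simp only [R]
      linear_combination (-s1) + s2 - s3 -(2 * π * p * b + π * Complex.I * b ^ 2) * Complex.I_sq
    · intro p h1 h2
      have hp : 2 * |p.im| + b⁻¹ ≤ b + b⁻¹ := by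
        have : |p.im| ≤ b / 2 := abs_le.2 ⟨by linarith, by linarith⟩
        linarith
      have b1 := norm_logPhi_le hb hb1 (inv_pos.2 hb) hp
      have b2 := norm_logPhi_le hb hb1 (inv_pos.2 hb) (z := -p) (by simpa using hp)
      have hle : ∀ s : ℝ, s ≤ |p.re| → Real.exp (π * b * s) ≤ Real.exp (3 * π / 2 * |p.re|) := by
        intro s hs
        refine Real.exp_le_exp.2 ?_
        calc π * b * s ≤ π * b * |p.re| := by gcongr
          _ ≤ 3 * π / 2 * |p.re| := by
            gcongr
            nlinarith [Real.pi_pos]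
      have hsq : ‖(π * Complex.I * p ^ 2 : ℂ)‖ ≤ 3 * π * Real.exp (3 * π / 2 * |p.re|) := by
        rw [norm_mul, norm_mul, Complex.norm_I, mul_one, norm_pow, Complex.norm_real,
          Real.norm_of_nonneg Real.pi_pos.le, Complex.sq_norm, Complex.normSq_apply]
        have h3 : p.im * p.im ≤ 1 := by
          have : |p.im| ≤ 1 := abs_le.2 ⟨by linarith, by linarith⟩
          nlinarith [abs_mul_abs_self p.im, abs_nonneg p.im]
        have h4 : p.re * p.re ≤ 2 * Real.exp |p.re| := by
          have := Real.quadratic_le_exp_of_nonneg (abs_nonneg p.re)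
          nlinarith [abs_mul_abs_self p.re, abs_nonneg p.re]
        have h5 : Real.exp |p.re| ≤ Real.exp (3 * π / 2 * |p.re|) := by
          refine Real.exp_le_exp.2 (le_mul_of_one_le_left (abs_nonneg _) ?_)
          linarith [Real.pi_gt_three]
        have h6 : 1 ≤ Real.exp (3 * π / 2 * |p.re|) := Real.one_le_exp (by positivity)
        calc π * (p.re * p.re + p.im * p.im) ≤ π * (3 * Real.exp (3 * π / 2 * |p.re|)) := by
              gcongr
              linarith
          _ = _ := by ring
      calc ‖R p‖ ≤ ‖logPhi b p‖ + ‖logPhi b (-p)‖ + ‖(π * Complex.I * p ^ 2 : ℂ)‖ :=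
            (norm_sub_le _ _).trans (by gcongr; exact norm_add_le _ _)
        _ ≤ Real.exp (3 * π / 2 * |p.re|) * (4 / (π * b ^ 3 * b⁻¹)) +
            Real.exp (3 * π / 2 * |p.re|) * (4 / (π * b ^ 3 * b⁻¹)) +
            3 * π * Real.exp (3 * π / 2 * |p.re|) := by
            refine add_le_add_three (b1.trans ?_) (b2.trans ?_) hsq
            · exact mul_le_mul_of_nonneg_right (hle _ (le_abs_self _)) (by positivity)
            · exact mul_le_mul_of_nonneg_right (hle _ (neg_le_abs _)) (by positivity)
        _ = _ := by ring
  simp only [R, neg_zero] at key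
  linear_combination key

theorem norm_logPhi_le_of_re_nonpos (hb : 0 < b) (hb1 : b ≤ 1) {z : ℂ} {δ : ℝ} (hδ : 0 < δ)
    (hz : 2 * |z.im| + δ ≤ b + b⁻¹) (hre : z.re ≤ 0) :
    ‖logPhi b z‖ ≤ 4 / (π * b ^ 3 * δ) := by
  refine (norm_logPhi_le hb hb1 hδ hz).trans (mul_le_of_le_one_left (by positivity) ?_)
  exact Real.exp_le_one_iff.2 (mul_nonpos_of_nonneg_of_nonpos (by positivity) hre)

theorem abs_re_logPhi_add_le_of_re_nonneg (hb : 0 < b) (hb1 : b ≤ 1) {z : ℂ} {δ : ℝ}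
    (hδ : 0 < δ) (hz : 2 * |z.im| + δ ≤ b + b⁻¹) (hre : 0 ≤ z.re) :
    |(logPhi b z).re + 2 * π * z.re * z.im| ≤ 3 * (4 / (π * b ^ 3 * δ)) := by
  have h := congrArg Complex.re (logPhi_add_logPhi_neg hb hb1 (z := z) (by linarith))
  have b1 := (Complex.abs_re_le_norm _).trans
    (norm_logPhi_le_of_re_nonpos hb hb1 hδ (z := -z) (by simpa using hz) (by simpa using hre))
  have b0 := (Complex.abs_re_le_norm _).trans
    (norm_logPhi_le_of_re_nonpos hb hb1 hδ (z := 0) (by simp; linarith [abs_nonneg z.im]) le_rfl)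
  have e : (π * Complex.I * z ^ 2 + 2 * logPhi b 0).re =
      -(2 * π * z.re * z.im) + 2 * (logPhi b 0).re := by
    simp [pow_two]
    ring
  rw [e, Complex.add_re] at h
  rw [abs_le] at b1 b0 ⊢
  constructor <;> linarith [b1.1, b1.2, b0.1, b0.2]

end

section
variable {b η δ : ℝ}

/-- The inverse quantum dilogarithm on the horizontal line `Im z = -η`. -/
def invPhiLine (b η x : ℝ) : ℂ := Complex.exp (-logPhi b (x + (-η : ℝ) * Complex.I))

/-- The Fourier-Laplace transform of the inverse quantum dilogarithm along `Im z = -η`. -/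
def invPhiFourier (b η : ℝ) (p : ℂ) : ℂ :=
  ∫ x : ℝ, Complex.exp (-2 * π * Complex.I * p * (x + (-η : ℝ) * Complex.I)) * invPhiLine b η x

theorem add_mul_I_re (x y : ℝ) : ((x : ℂ) + y * Complex.I).re = x := by simp

theorem add_mul_I_im (x y : ℝ) : ((x : ℂ) + y * Complex.I).im = y := by simp

theorem norm_exp_neg_logPhi_le_of_re_nonpos (hb : 0 < b) (hb1 : b ≤ 1) {z : ℂ} (hδ : 0 < δ)
    (hz : 2 * |z.im| + δ ≤ b + b⁻¹) (hre : z.re ≤ 0) :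
    ‖Complex.exp (-logPhi b z)‖ ≤ Real.exp (3 * (4 / (π * b ^ 3 * δ))) := by
  rw [Complex.norm_exp, Complex.neg_re]
  gcongr
  have h := (Complex.abs_re_le_norm _).trans (norm_logPhi_le_of_re_nonpos hb hb1 hδ hz hre)
  have h0 : 0 ≤ 4 / (π * b ^ 3 * δ) := by positivity
  linarith [(abs_le.1 h).1]

theorem norm_exp_neg_logPhi_le_of_re_nonneg (hb : 0 < b) (hb1 : b ≤ 1) {z : ℂ} (hδ : 0 < δ)
    (hz : 2 * |z.im| + δ ≤ b + b⁻¹) (hre : 0 ≤ z.re) :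
    ‖Complex.exp (-logPhi b z)‖ ≤
      Real.exp (3 * (4 / (π * b ^ 3 * δ))) * Real.exp (2 * π * z.im * z.re) := by
  rw [Complex.norm_exp, Complex.neg_re, ← Real.exp_add]
  gcongr
  have h := abs_re_logPhi_add_le_of_re_nonneg hb hb1 hδ hz hre
  linarith [(abs_le.1 h).1]

theorem norm_invPhiLine_le (hb : 0 < b) (hb1 : b ≤ 1) (hη : 0 < η) (hδ : 0 < δ)
    (h : 2 * η + δ ≤ b + b⁻¹) (x : ℝ) :
    ‖invPhiLine b η x‖ ≤ Real.exp (3 * (4 / (π * b ^ 3 * δ))) * Real.exp (-0 * x) ∧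
    ‖invPhiLine b η x‖ ≤ Real.exp (3 * (4 / (π * b ^ 3 * δ))) * Real.exp (-(2 * π * η) * x) := by
  have hz : 2 * |((x : ℂ) + (-η : ℝ) * Complex.I).im| + δ ≤ b + b⁻¹ := by
    rwa [add_mul_I_im, abs_neg, abs_of_pos hη]
  rcases le_total x 0 with hx | hx
  · have := norm_exp_neg_logPhi_le_of_re_nonpos hb hb1 hδ hz (by rwa [add_mul_I_re])
    refine ⟨by rw [neg_zero, zero_mul, Real.exp_zero, mul_one]; exact this, this.trans (le_mul_of_one_le_right (by positivity) ?_)⟩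
    refine Real.one_le_exp ?_
    have : 0 ≤ 2 * π * η := by positivity
    nlinarith
  · have := norm_exp_neg_logPhi_le_of_re_nonneg hb hb1 hδ hz (by rwa [add_mul_I_re])
    rw [add_mul_I_re, add_mul_I_im] at this
    have h2 : ‖invPhiLine b η x‖ ≤
        Real.exp (3 * (4 / (π * b ^ 3 * δ))) * Real.exp (-(2 * π * η) * x) := by
      refine this.trans_eq ?_
      ring_nf
    refine ⟨h2.trans ?_, h2⟩
    gcongr
    nlinarith [Real.pi_pos]

theorem continuous_invPhiLine (hb : 0 < b) (hb1 : b ≤ 1) (hη : 0 < η) (h : 2 * η < b + b⁻¹) :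
    Continuous (invPhiLine b η) := by
  unfold invPhiLine
  refine Complex.continuous_exp.comp (Continuous.neg ?_)
  refine continuous_iff_continuousAt.2 fun x => ?_
  refine ContinuousAt.comp (f := fun x : ℝ => ((x : ℂ) + (-η : ℝ) * Complex.I)) (g := logPhi b)
    (differentiableAt_logPhi hb hb1 ?_).continuousAt (by fun_prop)
  rwa [add_mul_I_im, abs_neg, abs_of_pos hη]

theorem invPhiFourier_eq_laplace (b η : ℝ) (p : ℂ) :
    invPhiFourier b η p = Complex.exp (-2 * π * η * p) *
      ∫ x : ℝ, invPhiLine b η x * Complex.exp (-2 * π * Complex.I * p * x) := by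
  rw [invPhiFourier, ← integral_const_mul]
  congr 1
  ext x
  rw [mul_left_comm, ← Complex.exp_add, mul_comm]
  congr 2
  push_cast
  linear_combination (2 * π * η * p : ℂ) * Complex.I_sq

theorem re_neg_two_pi_I_mul (p : ℂ) : (-2 * π * Complex.I * p).re = 2 * π * p.im := by
  simp

theorem differentiableAt_invPhiFourier (hb : 0 < b) (hb1 : b ≤ 1) (h : 2 * η < b + b⁻¹) {p : ℂ}
    (h0 : 0 < p.im) (h1 : p.im < η) : DifferentiableAt ℂ (invPhiFourier b η) p := by
  have hη := h0.trans h1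
  have hB := norm_invPhiLine_le hb hb1 hη (sub_pos.2 h) (by linarith)
  have hd := (hasDerivAt_laplace (continuous_invPhiLine hb hb1 hη h) (fun x => (hB x).1)
    (fun x => (hB x).2) (z := -2 * π * Complex.I * p)
    (by rw [re_neg_two_pi_I_mul]; positivity)
    (by rw [re_neg_two_pi_I_mul]; gcongr)).2.differentiableAt
  rw [funext (invPhiFourier_eq_laplace b η)]
  refine DifferentiableAt.mul (by fun_prop) ?_
  exact hd.comp p (f := fun p => -2 * π * Complex.I * p) (by fun_prop)

theorem norm_invPhiFourier_le (hb : 0 < b) (hb1 : b ≤ 1) (hη : 0 < η) (hδ : 0 < δ)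
    (h : 2 * η + δ ≤ b + b⁻¹) {p : ℂ} {ε : ℝ} (hε : 0 < ε) (h0 : ε ≤ p.im) (h1 : p.im + ε ≤ η) :
    ‖invPhiFourier b η p‖ ≤ Real.exp (3 * (4 / (π * b ^ 3 * δ))) * (2 / (2 * π * ε)) *
      Real.exp (-2 * π * η * p.re) := by
  have hB := norm_invPhiLine_le hb hb1 hη hδ h
  have := norm_laplace_le (fun x => (hB x).1) (fun x => (hB x).2) (δ := 2 * π * ε) (by positivity)
    (z := -2 * π * Complex.I * p)
    (by rw [re_neg_two_pi_I_mul, zero_add]; gcongr)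
    (by rw [re_neg_two_pi_I_mul, ← mul_sub]; gcongr; linarith)
  rw [invPhiFourier_eq_laplace, norm_mul, Complex.norm_exp, mul_comm]
  have e : (-2 * π * η * p : ℂ).re = -2 * π * η * p.re := by simp
  rw [e]
  gcongr

theorem norm_invPhi_kernel_le (hb : 0 < b) (hb1 : b ≤ 1) (hδ : 0 < δ) {p : ℂ} {ε : ℝ} {x y : ℝ}
    (hε : 0 ≤ ε) (h0 : ε ≤ p.im) (h1 : p.im + ε ≤ -y) (h2 : 2 * (-y) + δ ≤ b + b⁻¹) :
    ‖Complex.exp (-2 * π * Complex.I * p * (x + y * Complex.I)) *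
      Complex.exp (-logPhi b (x + y * Complex.I))‖ ≤
      Real.exp (π * (b + b⁻¹) * |p.re|) * Real.exp (3 * (4 / (π * b ^ 3 * δ))) *
        Real.exp (-(2 * π * ε) * |x|) := by
  have hz : 2 * |((x : ℂ) + y * Complex.I).im| + δ ≤ b + b⁻¹ := by
    rwa [add_mul_I_im, ← abs_neg, abs_of_nonneg (by linarith)]
  have e : (-2 * π * Complex.I * p * (x + y * Complex.I)).re =
      2 * π * p.im * x + 2 * π * p.re * y := by
    simp
    ring
  rw [norm_mul, Complex.norm_exp, e, Real.exp_add]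
  have hy : Real.exp (2 * π * p.re * y) ≤ Real.exp (π * (b + b⁻¹) * |p.re|) := by
    refine Real.exp_le_exp.2 ?_
    calc 2 * π * p.re * y = π * (2 * (-y)) * (-p.re) := by ring
      _ ≤ π * (2 * (-y)) * |p.re| := by
        gcongr
        · have : 0 ≤ -y := by linarith
          positivity
        · exact neg_le_abs _
      _ ≤ _ := by gcongr; linarith
  rcases le_total x 0 with hx | hx
  · have := norm_exp_neg_logPhi_le_of_re_nonpos hb hb1 hδ hz (by rwa [add_mul_I_re])
    have hx' : Real.exp (2 * π * p.im * x) ≤ Real.exp (-(2 * π * ε) * |x|) := by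
      refine Real.exp_le_exp.2 ?_
      rw [abs_of_nonpos hx]
      nlinarith [Real.pi_pos, mul_nonneg (mul_nonneg Real.pi_pos.le (neg_nonneg.2 hx))
        (sub_nonneg.2 h0)]
    calc _ ≤ Real.exp (-(2 * π * ε) * |x|) * Real.exp (π * (b + b⁻¹) * |p.re|) *
          Real.exp (3 * (4 / (π * b ^ 3 * δ))) := by gcongr
      _ = _ := by ring
  · have := norm_exp_neg_logPhi_le_of_re_nonneg hb hb1 hδ hz (by rwa [add_mul_I_re])
    rw [add_mul_I_re, add_mul_I_im] at this
    have hx' : Real.exp (2 * π * p.im * x) * Real.exp (2 * π * y * x) ≤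
        Real.exp (-(2 * π * ε) * |x|) := by
      rw [← Real.exp_add]
      refine Real.exp_le_exp.2 ?_
      rw [abs_of_nonneg hx]
      nlinarith [mul_nonneg (mul_nonneg Real.pi_pos.le hx) (by linarith : 0 ≤ -y - (p.im + ε))]
    calc _ ≤ Real.exp (2 * π * p.im * x) * Real.exp (π * (b + b⁻¹) * |p.re|) *
          (Real.exp (3 * (4 / (π * b ^ 3 * δ))) * Real.exp (2 * π * y * x)) := by gcongr
      _ = Real.exp (π * (b + b⁻¹) * |p.re|) * Real.exp (3 * (4 / (π * b ^ 3 * δ))) *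
          (Real.exp (2 * π * p.im * x) * Real.exp (2 * π * y * x)) := by ring
      _ ≤ _ := by gcongr

theorem invPhiFourier_eq_of_le (hb : 0 < b) (hb1 : b ≤ 1) {η' : ℝ} (hle : η' ≤ η)
    (h : 2 * η < b + b⁻¹) {p : ℂ} (h0 : 0 < p.im) (h1 : p.im < η') :
    invPhiFourier b η p = invPhiFourier b η' p := by
  obtain ⟨ε, hε, hε'⟩ := exists_between (lt_min h0 (sub_pos.2 h1))
  rw [lt_min_iff] at hε'
  have := integral_horizontal_line_eq (y₁ := -η) (y₂ := -η') (δ := 2 * π * ε)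
    (C := Real.exp (π * (b + b⁻¹) * |p.re|) *
      Real.exp (3 * (4 / (π * b ^ 3 * (b + b⁻¹ - 2 * η)))))
    (f := fun z => Complex.exp (-2 * π * Complex.I * p * z) * Complex.exp (-logPhi b z))
    (by positivity) (by linarith) ?_ ?_
  · exact this
  · intro z hz1 hz2
    have : 2 * |z.im| < b + b⁻¹ := by
      rw [abs_of_nonpos (by linarith)]; linarith
    have hd := differentiableAt_logPhi hb hb1 this
    exact DifferentiableAt.mul (by fun_prop) hd.neg.cexp
  · intro x y hy1 hy2
    exact norm_invPhi_kernel_le hb hb1 (by linarith) hε.le hε'.1.le (by linarith) (by linarith)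

theorem invPhiFourier_eq (hb : 0 < b) (hb1 : b ≤ 1) {η' : ℝ}
    (h : 2 * η < b + b⁻¹) (h' : 2 * η' < b + b⁻¹) {p : ℂ} (h0 : 0 < p.im) (h1 : p.im < η)
    (h1' : p.im < η') : invPhiFourier b η p = invPhiFourier b η' p := by
  rcases le_total η η' with hl | hl
  · exact (invPhiFourier_eq_of_le hb hb1 hl h' h0 h1).symm
  · exact invPhiFourier_eq_of_le hb hb1 hl h h0 h1'

theorem integrable_invPhi_kernel (hb : 0 < b) (hb1 : b ≤ 1) (h : 2 * η < b + b⁻¹) {p : ℂ}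
    (h0 : 0 < p.im) (h1 : p.im < η) :
    Integrable fun x : ℝ =>
      Complex.exp (-2 * π * Complex.I * p * (x + (-η : ℝ) * Complex.I)) * invPhiLine b η x := by
  obtain ⟨ε, hε, hε'⟩ := exists_between (lt_min h0 (sub_pos.2 h1))
  rw [lt_min_iff] at hε'
  have hc := continuous_invPhiLine hb hb1 (h0.trans h1) h
  refine ((integrable_exp_neg_mul_abs (by positivity : 0 < 2 * π * ε)).const_mul
    (Real.exp (π * (b + b⁻¹) * |p.re|) *
      Real.exp (3 * (4 / (π * b ^ 3 * (b + b⁻¹ - 2 * η)))))).mono'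
    (Continuous.aestronglyMeasurable (by fun_prop)) (.of_forall fun x => ?_)
  exact norm_invPhi_kernel_le hb hb1 (by linarith) hε.le hε'.1.le (by linarith) (by linarith)

theorem invPhiFourier_add (hb : 0 < b) (hb1 : b ≤ 1) (h : 2 * η < b + b⁻¹) {p : ℂ}
    (h0 : 0 < p.im) (h1 : p.im + b < η) :
    Complex.exp (π * Complex.I * b ^ 2) * invPhiFourier b η (p + Complex.I * b) =
      (Complex.exp (-2 * π * b * p) - 1) * invPhiFourier b η p := by
  have hpb : (p + Complex.I * b).im = p.im + b := by simp
  have i1 := integrable_invPhi_kernel hb hb1 h (p := p + Complex.I * b) (by rw [hpb]; linarith)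
    (by rw [hpb]; exact h1)
  have i2 := integrable_invPhi_kernel hb hb1 h h0 (by linarith)
  have hs : invPhiFourier b η p = invPhiFourier b (η - b) p :=
    invPhiFourier_eq hb hb1 h (by linarith) h0 (by linarith) (by linarith)
  have key : Complex.exp (-2 * π * b * p) * invPhiFourier b (η - b) p =
      invPhiFourier b η p +
        Complex.exp (π * Complex.I * b ^ 2) * invPhiFourier b η (p + Complex.I * b) := by
    simp only [invPhiFourier]
    rw [← integral_const_mul, ← integral_const_mul, ← integral_add i2 (i1.const_mul _)]
    congr 1
    ext x
    simp only [invPhiLine]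
    set z : ℂ := x + (-η : ℝ) * Complex.I with hz
    have ez : (x : ℂ) + (-(η - b) : ℝ) * Complex.I = z + Complex.I * b := by
      rw [hz]; push_cast; ring
    have him : (z + Complex.I * b / 2).im = -η + b / 2 := by simp [hz]
    have hf := exp_logPhi_sub hb hb1 (z := z + Complex.I * b / 2) (by
      rw [him, abs_of_nonpos (by linarith)]
      linarith)
    have e1 : z + Complex.I * b / 2 - Complex.I * b / 2 = z := by ring
    have e2 : z + Complex.I * b / 2 + Complex.I * b / 2 = z + Complex.I * b := by ring
    rw [e1, e2] at hf
    have hf' : Complex.exp (-logPhi b (z + Complex.I * b)) =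
        (1 + Complex.exp (2 * π * b * (z + Complex.I * b / 2))) * Complex.exp (-logPhi b z) := by
      rw [Complex.exp_neg, Complex.exp_neg]
      have n1 := Complex.exp_ne_zero (logPhi b z)
      have n2 := Complex.exp_ne_zero (logPhi b (z + Complex.I * b))
      field_simp
      rw [hf]
      ring_nf
    have e3 : Complex.exp (-2 * π * b * p) *
        Complex.exp (-2 * π * Complex.I * p * (z + Complex.I * b)) =
        Complex.exp (-2 * π * Complex.I * p * z) := by
      rw [← Complex.exp_add]
      congr 1
      linear_combination (-2 * π * p * b : ℂ) * Complex.I_sq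
    have e4 : Complex.exp (-2 * π * Complex.I * p * z) *
        Complex.exp (2 * π * b * (z + Complex.I * b / 2)) =
        Complex.exp (π * Complex.I * b ^ 2) *
          Complex.exp (-2 * π * Complex.I * (p + Complex.I * b) * z) := by
      rw [← Complex.exp_add, ← Complex.exp_add]
      congr 1
      linear_combination (2 * π * b * z : ℂ) * Complex.I_sq
    rw [ez, hf', ← mul_assoc, e3]
    linear_combination Complex.exp (-logPhi b z) * e4
  rw [← hs] at key
  linear_combination -key

/-- The product of the transform with the quantum dilogarithm is a Gaussian. -/
theorem invPhiFourier_mul_eq (hb : 0 < b) (hb1 : b < 1) (hη : b < η) (h : 2 * η < b + b⁻¹)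
    {p q : ℂ} (hp0 : 0 < p.im) (hp1 : p.im < η) (hq0 : 0 < q.im) (hq1 : q.im < η) :
    invPhiFourier b η p * Complex.exp (-π * Complex.I * p ^ 2) *
        Complex.exp (logPhi b (p - cB b)) =
      invPhiFourier b η q * Complex.exp (-π * Complex.I * q ^ 2) *
        Complex.exp (logPhi b (q - cB b)) := by
  set R : ℂ → ℂ := fun p => invPhiFourier b η p * Complex.exp (-π * Complex.I * p ^ 2) *
    Complex.exp (logPhi b (p - cB b)) with hR
  have hη0 : 0 < η := hb.trans hη
  have him : ∀ p : ℂ, (p - cB b).im = p.im - (b + b⁻¹) / 2 := by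
    intro p
    rw [Complex.sub_im]
    congr 1
    simp [cB, -Complex.ofReal_inv]
  have hre : ∀ p : ℂ, (p - cB b).re = p.re := by
    intro p
    simp [cB, -Complex.ofReal_inv]
  set y₀ := (η - b) / 2 with hy₀
  have hy₀pos : 0 < y₀ := by rw [hy₀]; linarith
  set δ := b + b⁻¹ - 2 * η with hδ
  have hδpos : 0 < δ := by linarith
  refine eq_of_strip_periodic (R := R) (α := 0) (β := η) (y₀ := y₀) (h := b)
    (κ := π * (b + b⁻¹))
    (C := Real.exp (3 * (4 / (π * b ^ 3 * δ))) * (2 / (2 * π * y₀)) *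
      Real.exp (3 * (4 / (π * b ^ 3 * (2 * y₀)))))
    hb hy₀pos (by linarith) ?_ ?_ ?_ ?_ hp0 hp1 hq0 hq1
  · rw [lt_div_iff₀ hb]
    have : π * (b + b⁻¹) * b = π * (b ^ 2 + 1) := by field_simp
    rw [this]
    nlinarith [Real.pi_pos, mul_pos Real.pi_pos (by nlinarith : 0 < 1 - b ^ 2)]
  · intro p h1 h2
    have d1 := differentiableAt_invPhiFourier hb hb1.le h h1 h2
    have d2 : DifferentiableAt ℂ (fun p => logPhi b (p - cB b)) p := by
      refine DifferentiableAt.comp (g := logPhi b) p (differentiableAt_logPhi hb hb1.le ?_)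
        (by fun_prop)
      rw [him, abs_of_nonpos (by linarith)]
      linarith
    exact (d1.mul (by fun_prop)).mul d2.cexp
  · intro p h1 h2
    have k1 := invPhiFourier_add hb hb1.le h h1 h2
    have hw : (p - cB b + Complex.I * b / 2).im = p.im - b⁻¹ / 2 := by
      rw [Complex.add_im, him]
      simp
      ring
    have k2 := exp_logPhi_sub hb hb1.le (z := p - cB b + Complex.I * b / 2) (by
      rw [hw]
      have : |p.im - b⁻¹ / 2| < b⁻¹ / 2 := abs_lt.2 ⟨by linarith, by linarith⟩
      linarith)
    have e1 : p - cB b + Complex.I * b / 2 - Complex.I * b / 2 = p - cB b := by ring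
    have e2 : p - cB b + Complex.I * b / 2 + Complex.I * b / 2 = p + Complex.I * b - cB b := by
      ring
    have hb' : (b : ℂ) ≠ 0 := by exact_mod_cast hb.ne'
    have e3 : Complex.exp (2 * π * b * (p - cB b + Complex.I * b / 2)) =
        -Complex.exp (2 * π * b * p) := by
      have : (2 * π * b * (p - cB b + Complex.I * b / 2) : ℂ) =
          2 * π * b * p - π * Complex.I := by
        rw [cB, Complex.ofReal_inv]
        field_simp
        ring
      rw [this, Complex.exp_sub, Complex.exp_pi_mul_I]
      ring
    rw [e1, e2, e3] at k2
    have e4 : Complex.exp (-π * Complex.I * (p + Complex.I * b) ^ 2) =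
        Complex.exp (-π * Complex.I * p ^ 2) * Complex.exp (2 * π * b * p) *
          Complex.exp (π * Complex.I * b ^ 2) := by
      rw [← Complex.exp_add, ← Complex.exp_add]
      congr 1
      linear_combination (-2 * π * b * p - π * Complex.I * b ^ 2 : ℂ) * Complex.I_sq
    have e5 : Complex.exp (-2 * π * b * p) * Complex.exp (2 * π * b * p) = 1 := by
      rw [← Complex.exp_add, ← Complex.exp_zero]
      ring_nf
    simp only [hR]
    rw [k2, e4]
    linear_combination (Complex.exp (-π * Complex.I * p ^ 2) * Complex.exp (2 * π * b * p) *
      Complex.exp (logPhi b (p + Complex.I * b - cB b))) * k1 +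
      (invPhiFourier b η p * Complex.exp (-π * Complex.I * p ^ 2) *
        Complex.exp (logPhi b (p + Complex.I * b - cB b))) * e5
  · intro p h1 h2
    have n1 := norm_invPhiFourier_le hb hb1.le hη0 hδpos (by linarith) hy₀pos h1 (by linarith)
    have n2 : ‖Complex.exp (-π * Complex.I * p ^ 2)‖ = Real.exp (2 * π * p.re * p.im) := by
      rw [Complex.norm_exp]
      congr 1
      simp [pow_two]
      ring
    have hz : 2 * |(p - cB b).im| + 2 * y₀ ≤ b + b⁻¹ := by
      rw [him, abs_of_nonpos (by linarith)]
      linarith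
    rw [hR]
    simp only
    rw [norm_mul, norm_mul, n2]
    set M := 4 / (π * b ^ 3 * (2 * y₀))
    have hM : 0 ≤ M := by positivity
    have hexp : ‖Complex.exp (logPhi b (p - cB b))‖ * (Real.exp (2 * π * p.re * p.im) *
        Real.exp (-2 * π * η * p.re)) ≤
        Real.exp (3 * M) * Real.exp (π * (b + b⁻¹) * |p.re|) := by
      rw [Complex.norm_exp, ← Real.exp_add, ← Real.exp_add, ← Real.exp_add]
      refine Real.exp_le_exp.2 ?_
      have hpi := Real.pi_pos
      rcases le_total p.re 0 with hx | hx
      · have := (Complex.abs_re_le_norm _).trans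
          (norm_logPhi_le_of_re_nonpos hb hb1.le (by positivity) hz (by rwa [hre]))
        rw [abs_of_nonpos hx]
        have h3 := mul_nonneg (mul_nonneg hpi.le (neg_nonneg.2 hx))
          (by linarith : 0 ≤ (b + b⁻¹) - 2 * η)
        have h4 := mul_nonneg (mul_nonneg hpi.le (neg_nonneg.2 hx))
          (by linarith : 0 ≤ p.im)
        linarith [(abs_le.1 this).2]
      · have := abs_re_logPhi_add_le_of_re_nonneg hb hb1.le (by positivity) hz (by rwa [hre])
        rw [him, hre] at this
        rw [abs_of_nonneg hx]
        have h3 := mul_nonneg (mul_nonneg hpi.le hx) hη0.le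
        linarith [(abs_le.1 this).2]
    calc _ ≤ Real.exp (3 * (4 / (π * b ^ 3 * δ))) * (2 / (2 * π * y₀)) *
          Real.exp (-2 * π * η * p.re) * Real.exp (2 * π * p.re * p.im) *
          ‖Complex.exp (logPhi b (p - cB b))‖ := by gcongr
      _ = Real.exp (3 * (4 / (π * b ^ 3 * δ))) * (2 / (2 * π * y₀)) *
          (‖Complex.exp (logPhi b (p - cB b))‖ * (Real.exp (2 * π * p.re * p.im) *
            Real.exp (-2 * π * η * p.re))) := by ring
      _ ≤ Real.exp (3 * (4 / (π * b ^ 3 * δ))) * (2 / (2 * π * y₀)) *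
          (Real.exp (3 * M) * Real.exp (π * (b + b⁻¹) * |p.re|)) := by gcongr
      _ = _ := by ring

end

section
variable {b η : ℝ}

theorem tendsto_invPhiLine_atBot (hb : 0 < b) (hb1 : b ≤ 1) (hη : 0 < η) (h : 2 * η < b + b⁻¹) :
    Filter.Tendsto (invPhiLine b η) Filter.atBot (nhds 1) := by
  have hl : Filter.Tendsto (fun x : ℝ => logPhi b (x + (-η : ℝ) * Complex.I)) Filter.atBot
      (nhds 0) := by
    have hexp : Filter.Tendsto (fun x : ℝ => Real.exp (π * b * x)) Filter.atBot (nhds 0) :=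
      Real.tendsto_exp_atBot.comp (Filter.tendsto_id.const_mul_atBot (by positivity))
    refine squeeze_zero_norm (a := fun x : ℝ => Real.exp (π * b * x) *
      (4 / (π * b ^ 3 * (b + b⁻¹ - 2 * η)))) (fun x => ?_) (by simpa using hexp.mul_const _)
    have := norm_logPhi_le hb hb1 (z := x + (-η : ℝ) * Complex.I) (sub_pos.2 h)
      (by rw [add_mul_I_im, abs_neg, abs_of_pos hη]; linarith)
    rwa [add_mul_I_re] at this
  have := hl.neg.cexp
  rw [neg_zero, Complex.exp_zero] at this
  exact this

theorem tendsto_invPhiLine_atTop (hb : 0 < b) (hb1 : b ≤ 1) (hη : 0 < η) (h : 2 * η < b + b⁻¹) :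
    Filter.Tendsto (invPhiLine b η) Filter.atTop (nhds 0) := by
  have hexp : Filter.Tendsto (fun x : ℝ => Real.exp (-(2 * π * η) * x)) Filter.atTop (nhds 0) :=
    Real.tendsto_exp_atBot.comp
      (Filter.tendsto_id.const_mul_atTop_of_neg (neg_lt_zero.2 (by positivity)))
  refine squeeze_zero_norm (fun x => (norm_invPhiLine_le hb hb1 hη (sub_pos.2 h)
    (by linarith) x).2) ?_
  simpa using hexp.const_mul _

/-- The transform has a simple pole at the origin. -/
theorem tendsto_mul_invPhiFourier (hb : 0 < b) (hb1 : b ≤ 1) (hη : 0 < η) (h : 2 * η < b + b⁻¹) :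
    Filter.Tendsto (fun ε : ℝ => (ε : ℂ) * invPhiFourier b η (Complex.I * ε))
      (nhdsWithin 0 (Set.Ioi 0)) (nhds (1 / (2 * π))) := by
  set C := Real.exp (3 * (4 / (π * b ^ 3 * (b + b⁻¹ - 2 * η))))
  have hB := norm_invPhiLine_le hb hb1 hη (sub_pos.2 h) (by linarith)
  have hscale : ∀ ε : ℝ, 0 < ε → (ε : ℂ) * invPhiFourier b η (Complex.I * ε) =
      Complex.exp (-2 * π * η * (Complex.I * ε)) *
        ∫ y : ℝ, invPhiLine b η (y / ε) * Complex.exp (2 * π * y) := by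
    intro ε hε
    have := Measure.integral_comp_div (fun x : ℝ => invPhiLine b η x *
      Complex.exp (-2 * π * Complex.I * (Complex.I * ε) * x)) ε
    rw [abs_of_pos hε, Complex.real_smul] at this
    rw [invPhiFourier_eq_laplace, mul_left_comm, ← this]
    congr 2
    ext y
    congr 2
    have : (ε : ℂ) ≠ 0 := by exact_mod_cast hε.ne'
    push_cast
    field_simp
    rw [Complex.I_sq]
    ring
  have hcontF := continuous_invPhiLine hb hb1 hη h
  have hinteg : Filter.Tendsto
      (fun ε : ℝ => ∫ y : ℝ, invPhiLine b η (y / ε) * Complex.exp (2 * π * y))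
      (nhdsWithin 0 (Set.Ioi 0))
      (nhds (∫ y : ℝ, (Set.Iic (0 : ℝ)).indicator (fun y : ℝ => Complex.exp (2 * π * y)) y)) := by
    refine tendsto_integral_filter_of_dominated_convergence
      (fun y => C * Real.exp (-(2 * π) * |y|)) ?_ ?_ ?_ ?_
    · refine Filter.Eventually.of_forall fun ε => Continuous.aestronglyMeasurable ?_
      exact (hcontF.comp (continuous_id.div_const ε)).mul (by fun_prop)
    · have hev : ∀ᶠ ε : ℝ in nhdsWithin 0 (Set.Ioi 0), ε ∈ Set.Ioo 0 (η / 2) :=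
        Ioo_mem_nhdsGT (by positivity)
      filter_upwards [hev] with ε hε
      refine Filter.Eventually.of_forall fun y => ?_
      have e : (2 * π * y : ℂ).re = 2 * π * y := by simp
      rw [norm_mul, Complex.norm_exp, e]
      refine norm_mul_exp_le_of_two_sided (A := 0) (B := 4 * π) (norm_nonneg _) ?_ ?_
        (by linarith) (by linarith)
      · simpa using (hB (y / ε)).1
      · rcases le_total y 0 with hy | hy
        · refine (hB (y / ε)).1.trans ?_
          refine mul_le_mul_of_nonneg_left (Real.exp_le_exp.2 ?_) (Real.exp_pos _).le
          have : 0 ≤ π * -y := mul_nonneg Real.pi_pos.le (by linarith)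
          linarith
        · refine (hB (y / ε)).2.trans ?_
          refine mul_le_mul_of_nonneg_left (Real.exp_le_exp.2 ?_) (Real.exp_pos _).le
          have h1 : 2 ≤ η / ε := by
            rw [le_div_iff₀ hε.1]; linarith [hε.2]
          have h2 : 0 ≤ π * y * (η / ε - 2) :=
            mul_nonneg (mul_nonneg Real.pi_pos.le hy) (by linarith)
          calc -(2 * π * η) * (y / ε) = -(2 * (π * y * (η / ε - 2))) - 4 * π * y := by ring
            _ ≤ -(4 * π) * y := by linarith
    · exact (integrable_exp_neg_mul_abs (by positivity)).const_mul C
    · have hne : ∀ᵐ y : ℝ, y ≠ 0 := by simp [ae_iff]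
      filter_upwards [hne] with y hy
      rcases lt_or_gt_of_ne hy with hy | hy
      · rw [Set.indicator_of_mem (Set.mem_Iic.2 hy.le)]
        have : Filter.Tendsto (fun ε : ℝ => y / ε) (nhdsWithin 0 (Set.Ioi 0)) Filter.atBot :=
          tendsto_inv_nhdsGT_zero.const_mul_atTop_of_neg hy
        simpa using ((tendsto_invPhiLine_atBot hb hb1 hη h).comp this).mul_const
          (Complex.exp (2 * π * y))
      · rw [Set.indicator_of_notMem (by simpa using hy)]
        have : Filter.Tendsto (fun ε : ℝ => y / ε) (nhdsWithin 0 (Set.Ioi 0)) Filter.atTop :=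
          tendsto_inv_nhdsGT_zero.const_mul_atTop hy
        simpa using ((tendsto_invPhiLine_atTop hb hb1 hη h).comp this).mul_const
          (Complex.exp (2 * π * y))
  rw [integral_indicator measurableSet_Iic, integral_exp_mul_complex_Iic (by simp [Real.pi_pos])]
    at hinteg
  have hpre : Filter.Tendsto (fun ε : ℝ => Complex.exp (-2 * π * η * (Complex.I * ε)))
      (nhdsWithin 0 (Set.Ioi 0)) (nhds 1) := by
    have : Continuous fun ε : ℝ => Complex.exp (-2 * π * η * (Complex.I * ε)) := by fun_prop
    simpa using (this.tendsto 0).mono_left nhdsWithin_le_nhds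
  have := hpre.mul hinteg
  simp only [Complex.ofReal_zero, mul_zero, Complex.exp_zero, one_mul] at this
  refine this.congr' ?_
  filter_upwards [self_mem_nhdsWithin] with ε hε
  exact (hscale ε hε).symm

theorem cB_im (b : ℝ) : (cB b).im = (b + b⁻¹) / 2 := by
  simp [cB, -Complex.ofReal_inv]

theorem conj_cB (b : ℝ) : (starRingEnd ℂ) (cB b) = -cB b := by
  simp [cB, map_ofNat, -Complex.ofReal_inv]
  ring

/-- The reflection symmetry of the Fourier transform of the inverse quantum dilogarithm. -/
theorem invPhiFourier_eq_conj (hb : 0 < b) (hb1 : b < 1) (hη : b < η) (h : 2 * η < b + b⁻¹)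
    {p : ℂ} (hp0 : 0 < p.im) (hp1 : p.im < η) :
    invPhiFourier b η p = Complex.exp (π * Complex.I * p ^ 2 - π * (b + b⁻¹) * p) *
      (starRingEnd ℂ) (invPhiFourier b η (-(starRingEnd ℂ) p)) := by
  have hη0 : 0 < η := hb.trans hη
  set J := invPhiFourier b η with hJ
  set q : ℂ := Complex.I * (η / 2 : ℝ) with hq
  have hqim : q.im = η / 2 := by
    rw [hq, mul_comm, Complex.im_ofReal_mul, Complex.I_im, mul_one]
  set R₀ : ℂ := J q * Complex.exp (-π * Complex.I * q ^ 2) *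
    Complex.exp (logPhi b (q - cB b)) with hR₀
  have hR : ∀ p : ℂ, 0 < p.im → p.im < η →
      J p * Complex.exp (-π * Complex.I * p ^ 2) * Complex.exp (logPhi b (p - cB b)) = R₀ :=
    fun p h0 h1 => invPhiFourier_mul_eq hb hb1 hη h h0 h1 (by linarith) (by linarith)
  set E : ℂ := Complex.exp (π * Complex.I * cB b ^ 2 + 2 * logPhi b 0)
  set K : ℂ → ℂ := fun p => (starRingEnd ℂ) (J (-(starRingEnd ℂ) p)) with hK
  have hrel : ∀ p : ℂ, 0 < p.im → p.im < η → (starRingEnd ℂ) R₀ * E * J p =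
      R₀ * (Complex.exp (π * Complex.I * p ^ 2 - π * (b + b⁻¹) * p) * K p) := by
    intro p h0 h1
    have r1 := hR p h0 h1
    have r2 := congrArg (starRingEnd ℂ) (hR (-(starRingEnd ℂ) p) (by simpa) (by simpa))
    have hinv := logPhi_add_logPhi_neg hb hb1.le (z := p - cB b) (by
      rw [Complex.sub_im, cB_im, abs_of_nonpos (by linarith)]
      linarith)
    simp only [map_mul, ← Complex.exp_conj, conj_logPhi, map_sub, map_neg, map_pow,
      Complex.conj_conj, conj_cB, Complex.conj_I, Complex.conj_ofReal] at r2
    have e2 : -p - -cB b = -(p - cB b) := by ring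
    rw [e2] at r2
    have hE : E * Complex.exp (-logPhi b (-(p - cB b))) *
        Complex.exp (-π * -Complex.I * (-p) ^ 2) =
        Complex.exp (-π * Complex.I * p ^ 2) * Complex.exp (logPhi b (p - cB b)) *
          Complex.exp (π * Complex.I * p ^ 2 - π * (b + b⁻¹) * p) := by
      simp only [E]
      rw [← Complex.exp_add, ← Complex.exp_add, ← Complex.exp_add, ← Complex.exp_add]
      congr 1
      have hc2 : 2 * π * Complex.I * p * cB b = -(π * (b + b⁻¹) * p) := by
        rw [cB]
        linear_combination (π * (b + b⁻¹) * p : ℂ) * Complex.I_sq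
      linear_combination (-1 : ℂ) * hinv + hc2
    rw [← r2, ← r1]
    linear_combination ((starRingEnd ℂ) (J (-(starRingEnd ℂ) p)) * J p) * hE
  have hlimJ := tendsto_mul_invPhiFourier hb hb1.le hη0 h
  have hlimK : Filter.Tendsto (fun ε : ℝ => (ε : ℂ) * K (Complex.I * ε))
      (nhdsWithin 0 (Set.Ioi 0)) (nhds (1 / (2 * π))) := by
    have h1 := (Complex.continuous_conj.tendsto _).comp hlimJ
    have e : (starRingEnd ℂ) (1 / (2 * π) : ℂ) = 1 / (2 * π) := by simp [map_ofNat]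
    rw [e] at h1
    refine h1.congr fun ε => ?_
    simp [hK, hJ]
  have hpi : (1 / (2 * π) : ℂ) ≠ 0 := by simp [Real.pi_ne_zero]
  have hev : ∀ᶠ ε : ℝ in nhdsWithin 0 (Set.Ioi 0), ε ∈ Set.Ioo 0 η := Ioo_mem_nhdsGT hη0
  have him : ∀ ε : ℝ, (Complex.I * ε).im = ε := fun ε => by simp
  have hRE : (starRingEnd ℂ) R₀ * E = R₀ := by
    have hpre : Filter.Tendsto (fun ε : ℝ => Complex.exp (π * Complex.I * (Complex.I * ε) ^ 2 -
        π * (b + b⁻¹) * (Complex.I * ε))) (nhdsWithin 0 (Set.Ioi 0)) (nhds 1) := by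
      have : Continuous fun ε : ℝ => Complex.exp (π * Complex.I * (Complex.I * ε) ^ 2 -
        π * (b + b⁻¹) * (Complex.I * ε)) := by fun_prop
      simpa using (this.tendsto 0).mono_left nhdsWithin_le_nhds
    have l1 := hlimJ.const_mul ((starRingEnd ℂ) R₀ * E)
    have l2 := (hpre.mul hlimK).const_mul R₀
    have l3 := tendsto_nhds_unique (l1.congr' ?_) l2
    · rw [one_mul] at l3
      exact mul_right_cancel₀ hpi l3
    · filter_upwards [hev] with ε hε
      have := hrel (Complex.I * ε) (by rw [him]; exact hε.1) (by rw [him]; exact hε.2)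
      linear_combination (ε : ℂ) * this
  have hR₀0 : R₀ ≠ 0 := by
    intro h0
    have hz : ∀ᶠ ε : ℝ in nhdsWithin 0 (Set.Ioi 0),
        (ε : ℂ) * invPhiFourier b η (Complex.I * ε) = 0 := by
      filter_upwards [hev] with ε hε
      have := hR (Complex.I * ε) (by rw [him]; exact hε.1) (by rw [him]; exact hε.2)
      rw [h0] at this
      simp only [mul_eq_zero, Complex.exp_ne_zero, or_false] at this
      exact mul_eq_zero_of_right _ this
    exact hpi (tendsto_nhds_unique hlimJ (tendsto_const_nhds.congr' (hz.mono fun _ h => h.symm)))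
  have := hrel p hp0 hp1
  rw [hRE] at this
  exact mul_left_cancel₀ hR₀0 this

end

section
variable {b : ℝ}

theorem two_le_add_inv (hb : 0 < b) : 2 ≤ b + b⁻¹ := by
  have h : b * b⁻¹ = 1 := mul_inv_cancel₀ hb.ne'
  nlinarith [sq_nonneg (b - b⁻¹), inv_pos.2 hb]

theorem Phi_inv_eq_invPhiLine {η : ℝ} (hη : 0 < η) (h : 2 * η < b + b⁻¹) (t : ℝ) :
    (Phi b (t + (-η : ℝ) * Complex.I))⁻¹ = invPhiLine b η t := by
  rw [Phi, if_neg (by rw [add_mul_I_im]; linarith), if_neg (by rw [add_mul_I_im]; linarith),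
    PhiS_eq_exp, ← Complex.exp_neg, invPhiLine]

theorem psiT_eq_invPhiFourier (hb : 0 < b) {a c : ℝ} (h0 : 0 < a + c) (h1 : a + c < 1 / 2)
    (s : ℝ) :
    psiT b a c s = Complex.exp (2 * π * (s + Complex.I * (b + b⁻¹) * a) * ((b + b⁻¹) * (a + c)) +
      π * Complex.I * cB b ^ 2 * (4 * a * (a + c) - (4 * (a - c) + 1) / 6)) *
      invPhiFourier b ((b + b⁻¹) * (a + c)) (s + Complex.I * (b + b⁻¹) * a) := by
  have hQ := two_le_add_inv hb
  rw [psiT, invPhiFourier, ← integral_const_mul]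
  congr 1
  ext t
  have e : (t : ℂ) - 2 * cB b * (a + c) =
      t + (-((b + b⁻¹) * (a + c)) : ℝ) * Complex.I := by
    rw [cB]
    push_cast
    ring
  rw [psiF, e, Phi_inv_eq_invPhiLine (by positivity) (by nlinarith), mul_assoc, mul_assoc,
    ← Complex.exp_add, ← Complex.exp_add, ← mul_assoc, ← Complex.exp_add, mul_comm]
  congr 2
  rw [cB]
  push_cast
  ring_nf
  simp only [Complex.I_sq, show Complex.I ^ 3 = -Complex.I by rw [pow_succ, Complex.I_sq]; ring]
  ring

theorem psiT_eq_conj_of_lt_one (hb : 0 < b) (hb1 : b < 1) {a c : ℝ} (ha : 0 < a) (hc : 0 < c)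
    (hac : 0 < 1 / 2 - a - c) (s : ℝ) :
    psiT b a c s = Complex.exp (π * Complex.I * s ^ 2) *
      (starRingEnd ℂ) (psiT b a (1 / 2 - a - c) (-s)) := by
  have hQ := two_le_add_inv hb
  have hbQ : b < (b + b⁻¹) / 2 := by
    have : 1 < b⁻¹ := (one_lt_inv₀ hb).2 hb1
    linarith
  set c' := 1 / 2 - a - c with hc'
  have l1 : (b + b⁻¹) * (a + c) < (b + b⁻¹) / 2 := by nlinarith
  have l2 : (b + b⁻¹) * (a + c') < (b + b⁻¹) / 2 := by nlinarith
  obtain ⟨η, hη, hη'⟩ := exists_between (max_lt hbQ (max_lt l1 l2))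
  rw [max_lt_iff, max_lt_iff] at hη
  obtain ⟨hη1, hη2, hη3⟩ := hη
  set p : ℂ := s + Complex.I * (b + b⁻¹) * a with hp
  have him : p.im = (b + b⁻¹) * a := by
    simp [hp, -Complex.ofReal_inv]
  have hp' : ((-s : ℝ) : ℂ) + Complex.I * (b + b⁻¹) * a = -(starRingEnd ℂ) p := by
    simp [hp, -Complex.ofReal_inv]
    ring
  have hpos : 0 < p.im := by rw [him]; positivity
  have hlt : p.im < (b + b⁻¹) * (a + c) := by rw [him]; gcongr; linarith
  have hlt' : p.im < (b + b⁻¹) * (a + c') := by rw [him]; gcongr; linarith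
  rw [psiT_eq_invPhiFourier hb (by linarith) (by linarith),
    psiT_eq_invPhiFourier hb (by linarith) (by linarith), hp', ← hp,
    invPhiFourier_eq hb hb1.le (η' := η) (by linarith) (by linarith) hpos hlt (by linarith),
    invPhiFourier_eq hb hb1.le (p := -(starRingEnd ℂ) p) (η' := η) (by linarith) (by linarith)
      (by simpa) (by simpa) (by simp; linarith),
    invPhiFourier_eq_conj hb hb1 hη1 (by linarith) hpos (by linarith), map_mul,
    ← Complex.exp_conj, ← mul_assoc (Complex.exp _) (Complex.exp _),
    ← mul_assoc (Complex.exp _) (Complex.exp _), ← Complex.exp_add, ← Complex.exp_add]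
  congr 2
  simp only [map_add, map_mul, map_sub, map_div₀, map_neg, map_pow, map_one, map_ofNat,
    Complex.conj_I, Complex.conj_ofReal, Complex.conj_conj, conj_cB]
  rw [hp, cB, hc']
  push_cast
  ring_nf
  simp only [Complex.I_sq, show Complex.I ^ 3 = -Complex.I by rw [pow_succ, Complex.I_sq]; ring]
  ring

theorem logPhi_inv (b : ℝ) : logPhi b⁻¹ = logPhi b := by
  ext z
  simp only [logPhi, phiKer, inv_inv, min_comm b⁻¹ b]
  congr 1
  ext t
  rw [Complex.ofReal_inv, ← div_eq_mul_inv, div_inv_eq_mul]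
  congr 1
  ring

theorem psiT_inv (hb : 0 < b) {a c : ℝ} (h0 : 0 < a + c) (h1 : a + c < 1 / 2) (s : ℝ) :
    psiT b⁻¹ a c s = psiT b a c s := by
  rw [psiT_eq_invPhiFourier hb h0 h1, psiT_eq_invPhiFourier (inv_pos.2 hb) h0 h1]
  simp only [invPhiFourier, invPhiLine, logPhi_inv, inv_inv, cB, add_comm b⁻¹ b,
    add_comm ((b⁻¹ : ℝ) : ℂ) b]

theorem add_inv_le_and_inv_cube_le_of_mem_Ioo (hb : b ∈ Set.Ioo (1 / 2 : ℝ) 1) :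
    b + b⁻¹ ≤ 3 ∧ (b ^ 3)⁻¹ ≤ 8 := by
  have h0 : 0 < b := by linarith [hb.1]
  have h2 : b⁻¹ ≤ 2 := by
    rw [inv_le_comm₀ h0 (by norm_num)]
    linarith [hb.1]
  refine ⟨by linarith [hb.2], ?_⟩
  rw [← inv_pow]
  calc b⁻¹ ^ 3 ≤ 2 ^ 3 := by gcongr
    _ = 8 := by norm_num

theorem eventually_mem_Ioo_half_one :
    ∀ᶠ b : ℝ in nhdsWithin 1 (Set.Iio 1), b ∈ Set.Ioo (1 / 2 : ℝ) 1 :=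
  Ioo_mem_nhdsLT (by norm_num)

theorem tendsto_contourPt (t : ℝ) :
    Filter.Tendsto (fun b : ℝ => contourPt b t) (nhdsWithin 1 (Set.Iio 1))
      (nhds (contourPt 1 t)) := by
  have : Continuous fun b : ℝ => contourPt b t := by unfold contourPt; fun_prop
  exact (this.tendsto 1).mono_left nhdsWithin_le_nhds

theorem tendsto_ofReal_one :
    Filter.Tendsto (fun b : ℝ => (b : ℂ)) (nhdsWithin 1 (Set.Iio 1)) (nhds ((1 : ℝ) : ℂ)) :=
  (Complex.continuous_ofReal.tendsto 1).mono_left nhdsWithin_le_nhds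

theorem tendsto_add_inv :
    Filter.Tendsto (fun b : ℝ => b + b⁻¹) (nhdsWithin 1 (Set.Iio 1)) (nhds (1 + 1⁻¹)) :=
  ((continuousAt_id.add (continuousAt_inv₀ one_ne_zero)).tendsto).mono_left nhdsWithin_le_nhds

theorem tendsto_logPhiAmp (t : ℝ) :
    Filter.Tendsto (fun b : ℝ => logPhiAmp b t) (nhdsWithin 1 (Set.Iio 1))
      (nhds (logPhiAmp 1 t)) := by
  have h1 := tendsto_contourPt t
  have h2 := tendsto_ofReal_one
  unfold logPhiAmp
  refine Filter.Tendsto.inv₀ ?_ ?_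
  · exact ((((Complex.continuous_sinh.tendsto _).comp (h1.mul h2)).const_mul 4).mul
      ((Complex.continuous_sinh.tendsto _).comp (h1.div h2 (by simp)))).mul h1
  · exact mul_ne_zero (mul_ne_zero (mul_ne_zero (by norm_num)
      (sinh_contourPt_mul_ne_zero one_pos le_rfl t)) (sinh_contourPt_div_ne_zero one_pos t))
      (contourPt_ne_zero one_pos t)

theorem tendsto_logPhi {θ : ℝ} (h0 : 0 < θ) (h1 : θ < 1 / 2) (x : ℝ) :
    Filter.Tendsto (fun b : ℝ => logPhi b (x + (-((b + b⁻¹) * θ) : ℝ) * Complex.I))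
      (nhdsWithin 1 (Set.Iio 1))
      (nhds (logPhi 1 (x + (-((1 + 1⁻¹) * θ) : ℝ) * Complex.I))) := by
  have hz : Filter.Tendsto (fun b : ℝ => ((x : ℂ) + (-((b + b⁻¹) * θ) : ℝ) * Complex.I))
      (nhdsWithin 1 (Set.Iio 1)) (nhds (x + (-((1 + 1⁻¹) * θ) : ℝ) * Complex.I)) :=
    (((Complex.continuous_ofReal.tendsto _).comp
      (tendsto_add_inv.mul_const θ).neg).mul_const Complex.I).const_add _
  have hinteg : Filter.Tendsto (fun b : ℝ => ∫ t : ℝ, logPhiAmp b t *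
      Complex.exp (-2 * Complex.I * (x + (-((b + b⁻¹) * θ) : ℝ) * Complex.I) * t))
      (nhdsWithin 1 (Set.Iio 1)) (nhds (∫ t : ℝ, logPhiAmp 1 t *
        Complex.exp (-2 * Complex.I * (x + (-((1 + 1⁻¹) * θ) : ℝ) * Complex.I) * t))) := by
    refine tendsto_integral_filter_of_dominated_convergence
      (fun t => 2 / π * 8 * Real.exp (-(2 * (1 - 2 * θ)) * |t|)) ?_ ?_ ?_ ?_
    · filter_upwards [eventually_mem_Ioo_half_one] with b hb
      have := continuous_logPhiAmp (by linarith [hb.1]) hb.2.le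
      exact Continuous.aestronglyMeasurable (by fun_prop)
    · filter_upwards [eventually_mem_Ioo_half_one] with b hb
      refine .of_forall fun t => ?_
      have hb0 : 0 < b := by linarith [hb.1]
      have hQ := two_le_add_inv hb0
      have e : (-2 * Complex.I * (x + (-((b + b⁻¹) * θ) : ℝ) * Complex.I) * t).re =
          2 * (-((b + b⁻¹) * θ)) * t := by
        rw [Complex.re_mul_ofReal, re_neg_two_I_mul, add_mul_I_im]
      rw [norm_mul, Complex.norm_exp, e]
      calc _ ≤ 2 / (π * b ^ 3) * Real.exp (-((b + b⁻¹) * |t|)) *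
            Real.exp (2 * (-((b + b⁻¹) * θ)) * t) := by
            gcongr
            exact norm_logPhiAmp_le hb0 hb.2.le t
        _ = 2 / π * (b ^ 3)⁻¹ * Real.exp (-((b + b⁻¹) * |t|) + 2 * (-((b + b⁻¹) * θ)) * t) := by
            rw [Real.exp_add]; field_simp
        _ ≤ _ := by
            have := (add_inv_le_and_inv_cube_le_of_mem_Ioo hb).2
            refine mul_le_mul (by gcongr) (Real.exp_le_exp.2 ?_) (by positivity) (by positivity)
            have h3 : 0 ≤ (b + b⁻¹) * θ * (|t| + t) :=
              mul_nonneg (by positivity) (by linarith [neg_abs_le t])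
            have h4 : 0 ≤ (b + b⁻¹ - 2) * ((1 - 2 * θ) * |t|) :=
              mul_nonneg (by linarith) (mul_nonneg (by linarith) (abs_nonneg t))
            nlinarith
    · exact (integrable_exp_neg_mul_abs (by linarith)).const_mul _
    · exact .of_forall fun t => (tendsto_logPhiAmp t).mul
        ((hz.const_mul (-2 * Complex.I)).mul_const (t : ℂ)).cexp
  have hpre := ((tendsto_ofReal_one.const_mul (π : ℂ)).mul hz).cexp
  rw [logPhi_eq_laplace one_pos le_rfl]
  refine (hpre.mul hinteg).congr' ?_
  filter_upwards [eventually_mem_Ioo_half_one] with b hb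
  rw [logPhi_eq_laplace (by linarith [hb.1]) hb.2.le]

theorem tendsto_psiT {a c : ℝ} (ha : 0 < a) (hc : 0 < c) (hac : a + c < 1 / 2) (s : ℝ) :
    Filter.Tendsto (fun b : ℝ => psiT b a c s) (nhdsWithin 1 (Set.Iio 1))
      (nhds (psiT 1 a c s)) := by
  have hQ : Filter.Tendsto (fun b : ℝ => (b : ℂ) + (b⁻¹ : ℝ)) (nhdsWithin 1 (Set.Iio 1))
      (nhds ((1 : ℝ) + (1⁻¹ : ℝ))) := by
    simpa only [Function.comp_def, Complex.ofReal_add] using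
      (Complex.continuous_ofReal.tendsto _).comp tendsto_add_inv
  have hp : Filter.Tendsto (fun b : ℝ => (s : ℂ) + Complex.I * (b + (b⁻¹ : ℝ)) * a)
      (nhdsWithin 1 (Set.Iio 1)) (nhds (s + Complex.I * ((1 : ℝ) + (1⁻¹ : ℝ)) * a)) :=
    ((hQ.const_mul _).mul_const _).const_add _
  have hcB : Filter.Tendsto cB (nhdsWithin 1 (Set.Iio 1)) (nhds (cB 1)) :=
    (hQ.const_mul _).div_const 2
  have hJ : Filter.Tendsto (fun b : ℝ => invPhiFourier b ((b + b⁻¹) * (a + c))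
      (s + Complex.I * (b + (b⁻¹ : ℝ)) * a)) (nhdsWithin 1 (Set.Iio 1))
      (nhds (invPhiFourier 1 ((1 + 1⁻¹) * (a + c))
        (s + Complex.I * ((1 : ℝ) + (1⁻¹ : ℝ)) * a))) := by
    set ε := 2 * min a c
    set δ := 2 * (1 - 2 * (a + c))
    have hε : 0 < ε := mul_pos two_pos (lt_min ha hc)
    have hδ : 0 < δ := by simp only [δ]; linarith
    refine tendsto_integral_filter_of_dominated_convergence
      (fun x => Real.exp (π * 3 * |s|) * Real.exp (3 * (4 / (π * δ) * 8)) *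
        Real.exp (-(2 * π * ε) * |x|)) ?_ ?_ ?_ ?_
    · filter_upwards [eventually_mem_Ioo_half_one] with b hb
      have hb0 : 0 < b := by linarith [hb.1]
      have hQ := two_le_add_inv hb0
      have := continuous_invPhiLine (η := (b + b⁻¹) * (a + c)) hb0 hb.2.le (by positivity)
        (by nlinarith)
      exact Continuous.aestronglyMeasurable (by fun_prop)
    · filter_upwards [eventually_mem_Ioo_half_one] with b hb
      refine .of_forall fun x => ?_
      have hb0 : 0 < b := by linarith [hb.1]
      have hQ := two_le_add_inv hb0
      obtain ⟨hQ3, hb8⟩ := add_inv_le_and_inv_cube_le_of_mem_Ioo hb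
      have him : (s + Complex.I * (b + (b⁻¹ : ℝ)) * a : ℂ).im = (b + b⁻¹) * a := by
        simp [-Complex.ofReal_inv]
      have hre : (s + Complex.I * (b + (b⁻¹ : ℝ)) * a : ℂ).re = s := by
        simp [-Complex.ofReal_inv]
      have hεa : ε ≤ (b + b⁻¹) * a := by
        calc ε ≤ 2 * a := mul_le_mul_of_nonneg_left (min_le_left a c) zero_le_two
          _ ≤ _ := by gcongr
      have hεc : ε ≤ (b + b⁻¹) * c := by
        calc ε ≤ 2 * c := mul_le_mul_of_nonneg_left (min_le_right a c) zero_le_two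
          _ ≤ _ := by gcongr
      have := norm_invPhi_kernel_le hb0 hb.2.le hδ (x := x)
        (p := s + Complex.I * (b + (b⁻¹ : ℝ)) * a) (y := -((b + b⁻¹) * (a + c))) hε.le
        (by rw [him]; exact hεa) (by rw [him]; linarith)
        (by simp only [δ]; nlinarith)
      refine this.trans ?_
      rw [hre]
      have e : 4 / (π * b ^ 3 * δ) = 4 / (π * δ) * (b ^ 3)⁻¹ := by field_simp
      rw [e]
      gcongr
    · exact (integrable_exp_neg_mul_abs (by positivity)).const_mul _
    · refine .of_forall fun x => ?_
      have hz : Filter.Tendsto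
          (fun b : ℝ => ((x : ℂ) + (-((b + b⁻¹) * (a + c)) : ℝ) * Complex.I))
          (nhdsWithin 1 (Set.Iio 1)) (nhds (x + (-((1 + 1⁻¹) * (a + c)) : ℝ) * Complex.I)) :=
        (((Complex.continuous_ofReal.tendsto _).comp
          (tendsto_add_inv.mul_const (a + c)).neg).mul_const Complex.I).const_add _
      exact ((hp.const_mul (-2 * π * Complex.I)).mul hz).cexp.mul
        (tendsto_logPhi (by linarith) hac x).neg.cexp
  rw [psiT_eq_invPhiFourier one_pos (by linarith) hac]
  have hpre := (((hp.const_mul (2 * π : ℂ)).mul (hQ.mul_const (a + c : ℂ))).add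
    (((hcB.pow 2).const_mul (π * Complex.I)).mul_const
      (4 * a * (a + c) - (4 * (a - c) + 1) / 6 : ℂ))).cexp
  refine (hpre.mul hJ).congr' ?_
  filter_upwards [eventually_mem_Ioo_half_one] with b hb
  rw [psiT_eq_invPhiFourier (by linarith [hb.1]) (by linarith) hac]

/-- The Fourier transform of `ψ_{a,c}` in terms of the complex conjugate of that of `ψ_{a,b}`. -/
theorem psiT_eq_conj (hb : 0 < b) {a c : ℝ} (ha : 0 < a) (hc : 0 < c)
    (hac : 0 < 1 / 2 - a - c) (s : ℝ) :
    psiT b a c s = Complex.exp (π * Complex.I * s ^ 2) *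
      (starRingEnd ℂ) (psiT b a (1 / 2 - a - c) (-s)) := by
  rcases lt_trichotomy b 1 with h | rfl | h
  · exact psiT_eq_conj_of_lt_one hb h ha hc hac s
  · refine tendsto_nhds_unique (tendsto_psiT ha hc (by linarith) s)
      (Filter.Tendsto.congr' ?_ (((Complex.continuous_conj.tendsto _).comp
        (tendsto_psiT ha hac (by linarith) (-s))).const_mul _))
    filter_upwards [eventually_mem_Ioo_half_one] with b hb
    exact (psiT_eq_conj_of_lt_one (by linarith [hb.1]) hb.2 ha hc hac s).symm
  · rw [← psiT_inv hb (by linarith) (by linarith), ← psiT_inv hb (by linarith) (by linarith)]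
    exact psiT_eq_conj_of_lt_one (inv_pos.2 hb) (inv_lt_one_of_one_lt₀ h) ha hc hac s

end

/-- Lemma 2, eq. (23) of the paper (first tetrahedral symmetry):
`g_{a,c}(x,y) = conj(g_{a,b}(-x, y-x-1/2)) e^{πix/2}` with `b = 1/2 - a - c`. -/
theorem gW_first_symmetry (bb : ℝ) (hbb : 0 < bb) (a c : ℝ)
    (ha : 0 < a) (hc : 0 < c) (hb : 0 < 1 / 2 - a - c) (x y : ℝ) :
    gW bb a c x y =
      (starRingEnd ℂ) (gW bb a (1 / 2 - a - c) (-x) (y - x - 1 / 2)) *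
        Complex.exp (π * Complex.I * x / 2) := by
  rw [gW, gW, Complex.conj_tsum, ← tsum_mul_right]
  conv_rhs => rw [← (Equiv.neg ℤ).tsum_eq]
  refine tsum_congr fun m => ?_
  obtain ⟨n, hn⟩ : ∃ n : ℤ, m ^ 2 - m = 2 * n := by
    obtain ⟨n, hn⟩ := Int.even_mul_pred_self m
    exact ⟨n, by linear_combination hn⟩
  have hn' : (m : ℂ) ^ 2 - m = 2 * n := by exact_mod_cast hn
  have hs : -x + ((Equiv.neg ℤ m : ℤ) : ℝ) = -(x + m) := by
    rw [Equiv.neg_apply]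
    push_cast
    ring
  have hper := Complex.exp_int_mul_two_pi_mul_I n
  rw [hs, psiT', psiT', psiT_eq_conj hbb ha hc hb (x + m), map_mul, map_mul, ← Complex.exp_conj,
    ← Complex.exp_conj]
  set K := (starRingEnd ℂ) (psiT bb a (1 / 2 - a - c) (-(x + m)))
  calc _ = Complex.exp (Complex.I * π * y * (x + 2 * m)) * K := by
        rw [← mul_assoc, ← Complex.exp_add, mul_right_comm, ← Complex.exp_add]
        congr 2
        push_cast
        ring
    _ = Complex.exp (Complex.I * π * y * (x + 2 * m)) * Complex.exp (n * (2 * π * Complex.I)) *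
        K := by rw [hper, mul_one]
    _ = _ := by
        rw [mul_right_comm _ K, mul_right_comm _ K, ← Complex.exp_add, ← Complex.exp_add,
          ← Complex.exp_add]
        congr 2
        rw [Equiv.neg_apply]
        simp only [map_add, map_mul, map_neg, map_pow, map_ofNat, map_intCast,
          Complex.conj_I, Complex.conj_ofReal]
        push_cast
        linear_combination (-π * Complex.I) * hn'
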